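/- arXiv:1109.5628 — 2 statements merged into one kernel-verified Lean document; each statement's English description precedes it below -/
import Mathlib

section
/- Let (R,m) be a Noetherian complete local ring with infinite residue class field, and let M be a finitely generated R-module with dim_R M = dim R ≥ 2. Let Q be a parameter ideal of R. Then −e_1(Q,M) ≤ T_Q^{(1)}(M), where T_Q^{(1)}(M) = Σ_{j=1}^{r−1} C(r−2, j−1) · hdeg_Q(M_j) with r = dim_R M. -/
open IsLocalRing

section Defs

variable (R : Type) [CommRing R]

/-- The length of a module, as the Krull dimension of its lattice of submodules. -/
noncomputable def mLength (M : Type) [AddCommGroup M] [Module R M] : WithBot ℕ∞ :=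
  Order.krullDim (Submodule R M)

/-- The (Krull) dimension of a module. -/
noncomputable def mDim (M : Type) [AddCommGroup M] [Module R M] : WithBot ℕ∞ :=
  ringKrullDim (R ⧸ Submodule.annihilator (⊤ : Submodule R M))

/-- `f` is eventually given by the Hilbert-type polynomial of degree `t` with
coefficients `s 0, …, s t` (written in the binomial basis with alternating signs). -/
def IsHilbPolyAt (f : ℕ → WithBot ℕ∞) (t : ℕ) (s : ℕ → ℤ) : Prop :=
  ∃ N : ℕ, ∀ n ≥ N, ∃ l : ℕ, f n = (l : ℕ∞) ∧
    (l : ℤ) = ∑ i ∈ Finset.range (t + 1), (-1 : ℤ) ^ i * s i * ((n + t - i).choose (t - i) : ℤ)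

/-- `s 0, …, s t` are the Hilbert coefficients `e_i(I, M)`, i.e.
`λ(M/I^{n+1}M) = ∑ (-1)^i e_i(I,M) C(n+t-i, t-i)` for `n ≫ 0`. -/
def HasHilbCoeffs (I : Ideal R) (M : Type) [AddCommGroup M] [Module R M]
    (t : ℕ) (s : ℕ → ℤ) : Prop :=
  IsHilbPolyAt (fun n => mLength R (M ⧸ (I ^ (n + 1) • (⊤ : Submodule R M)))) t s

/-- The unmixed component `U_M(0)` of `M`: the largest submodule of dimension `< dim M`. -/
noncomputable def unmixedComp (M : Type) [AddCommGroup M] [Module R M] : Submodule R M :=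
  sSup {N : Submodule R M | mDim R ↥N < mDim R M}

/-- `x` is a d-sequence on `M`. -/
def IsDSeq {r : ℕ} (x : Fin r → R) (M : Type) [AddCommGroup M] [Module R M] : Prop :=
  ∀ i j : Fin r, i ≤ j →
    Submodule.comap (LinearMap.lsmul R M (x i * x j))
        (Ideal.span (x '' {k | k < i}) • (⊤ : Submodule R M))
      = Submodule.comap (LinearMap.lsmul R M (x j))
        (Ideal.span (x '' {k | k < i}) • (⊤ : Submodule R M))

/-- `x` is a standard (d⁺-) system: all power sequences in any order are d-sequences. -/
def IsStandardSeq {r : ℕ} (x : Fin r → R) (M : Type) [AddCommGroup M] [Module R M] : Prop :=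
  ∀ n : Fin r → ℕ, (∀ k, 1 ≤ n k) → ∀ σ : Equiv.Perm (Fin r),
    IsDSeq R (fun k => x (σ k) ^ n (σ k)) M

/-- The integral closure of an ideal, as a set. -/
def intClos (Q : Ideal R) : Set R :=
  {x : R | ∃ n : ℕ, 0 < n ∧ ∃ a : ℕ → R, (∀ i, 1 ≤ i → i ≤ n → a i ∈ Q ^ i) ∧
    x ^ n + ∑ i ∈ Finset.Icc 1 n, a i * x ^ (n - i) = 0}

variable [IsLocalRing R]

/-- `h ∈ I` is superficial for `M` with respect to `I`. -/
def IsSuperficial (I : Ideal R) (M : Type) [AddCommGroup M] [Module R M] (h : R) : Prop :=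
  h ∈ I ∧ ∃ c N : ℕ, ∀ n ≥ N,
    Submodule.comap (LinearMap.lsmul R M h) (I ^ (n + 1) • (⊤ : Submodule R M))
        ⊓ (I ^ c • (⊤ : Submodule R M))
      = I ^ n • (⊤ : Submodule R M)

/-- `Q` is a parameter ideal for `M` (`r` the dimension of `M`):
generated by `r` elements of the maximal ideal with `M/QM` of finite length. -/
def IsParamIdeal (Q : Ideal R) (M : Type) [AddCommGroup M] [Module R M] (r : ℕ) : Prop :=
  Q ≤ maximalIdeal R ∧ (∃ x : Fin r → R, Q = Ideal.span (Set.range x)) ∧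
    IsFiniteLength R (M ⧸ Q • (⊤ : Submodule R M))

/-- Local cohomology `H^i_𝔪(M)` with support in the maximal ideal. -/
noncomputable def LC (i : ℕ) (M : Type) [AddCommGroup M] [Module R M] : ModuleCat R :=
  (localCohomology (maximalIdeal R) i).obj (ModuleCat.of R M)

/-- `M` is Cohen–Macaulay: there is a regular sequence on `M` in the maximal ideal
whose length equals `dim M`. -/
def IsCM (M : Type) [AddCommGroup M] [Module R M] : Prop :=
  ∃ rs : List R, (∀ x ∈ rs, x ∈ maximalIdeal R) ∧ RingTheory.Sequence.IsRegular M rs ∧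
    (rs.length : WithBot ℕ∞) = mDim R M

/-- `M` is unmixed: `dim R̂/p = dim M` for every associated prime `p` of the completion `M̂`. -/
def IsUnmixed (M : Type) [AddCommGroup M] [Module R M] : Prop :=
  ∀ p ∈ associatedPrimes (AdicCompletion (maximalIdeal R) R)
      (AdicCompletion (maximalIdeal R) M),
    ringKrullDim ((AdicCompletion (maximalIdeal R) R) ⧸ p) = mDim R M

/-- `M` is generalized Cohen–Macaulay: `H^i_𝔪(M)` has finite length for `i < r = dim M`. -/
def IsGenCM (M : Type) [AddCommGroup M] [Module R M] (r : ℕ) : Prop :=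
  ∀ i < r, IsFiniteLength R ↥(LC R i M)

/-- The set `Λ(M)` of first Hilbert coefficients of parameter ideals for `M`. -/
def Lambda (M : Type) [AddCommGroup M] [Module R M] (r : ℕ) : Set ℤ :=
  {a : ℤ | ∃ (Q : Ideal R) (e : ℕ → ℤ),
    IsParamIdeal R Q M r ∧ HasHilbCoeffs R Q M r e ∧ e 1 = a}

/-- A standard parameter ideal: one generated by a standard system of parameters. -/
def IsStandardParamIdeal (Q : Ideal R) (M : Type) [AddCommGroup M] [Module R M]
    (r : ℕ) : Prop :=
  IsParamIdeal R Q M r ∧ ∃ x : Fin r → R, Q = Ideal.span (Set.range x) ∧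
    IsStandardSeq R x M

/-- `M` is Buchsbaum: every parameter ideal for `M` is standard. -/
def IsBuchsbaum (M : Type) [AddCommGroup M] [Module R M] (r : ℕ) : Prop :=
  ∀ Q : Ideal R, IsParamIdeal R Q M r → IsStandardParamIdeal R Q M r

/-- `M` is a Vasconcelos module. -/
def IsVasconcelos (M : Type) [AddCommGroup M] [Module R M] : Prop :=
  mDim R M ≤ 0 ∨ (0 < mDim R M ∧ ∃ (r : ℕ) (Q : Ideal R) (e : ℕ → ℤ),
    mDim R M = (r : ℕ∞) ∧ IsParamIdeal R Q M r ∧ HasHilbCoeffs R Q M r e ∧ e 1 = 0)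

/-- A Gorenstein local ring: Noetherian, Cohen–Macaulay, with an irreducible parameter ideal. -/
def IsGorensteinLocalRing : Prop :=
  IsNoetherianRing R ∧ IsCM R R ∧ ∃ (r : ℕ) (Q : Ideal R),
    mDim R R = (r : ℕ∞) ∧ IsParamIdeal R Q R r ∧
    ∀ I J : Ideal R, Q = I ⊓ J → Q = I ∨ Q = J

/-- `E` is an injective envelope of the residue field `R/𝔪`. -/
def IsInjEnvResidue (E : Type) [AddCommGroup E] [Module R E] : Prop :=
  Module.Injective R E ∧ ∃ ι : (R ⧸ maximalIdeal R) →ₗ[R] E, Function.Injective ι ∧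
    ∀ N : Submodule R E, N ⊓ LinearMap.range ι = ⊥ → N = ⊥

end Defs

/-- A (not necessarily local) Cohen–Macaulay ring: Noetherian,
with all localizations at primes Cohen–Macaulay. -/
def IsCMRing (S : Type) [CommRing S] : Prop :=
  IsNoetherianRing S ∧ ∀ (p : Ideal S) [p.IsPrime],
    IsCM (Localization.AtPrime p) (Localization.AtPrime p)

/-- A (not necessarily local) Gorenstein ring. -/
def IsGorensteinRing (S : Type) [CommRing S] : Prop :=
  IsNoetherianRing S ∧ ∀ (p : Ideal S) [p.IsPrime],
    IsGorensteinLocalRing (Localization.AtPrime p)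

/-- `HDegRel R I E M v` : `v` is the homological degree `hdeg_I(M)` computed
with Matlis duals taken relative to `E`. -/
inductive HDegRel (R : Type) [CommRing R] [IsLocalRing R] (I : Ideal R)
    (E : Type) [AddCommGroup E] [Module R E] : ModuleCat R → ℕ → Prop where
  | base : ∀ (M : ModuleCat R) (l : ℕ), mDim R M ≤ 0 → mLength R M = (l : ℕ∞) →
      HDegRel R I E M l
  | step : ∀ (M : ModuleCat R) (r : ℕ), mDim R M = (r : ℕ∞) → 0 < r →
      ∀ (e : ℕ → ℤ) (e0 : ℕ), HasHilbCoeffs R I M r e → e 0 = (e0 : ℤ) →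
      ∀ v : ℕ → ℕ,
        (∀ j < r, HDegRel R I E (ModuleCat.of R ((LC R j M) →ₗ[R] E)) (v j)) →
      HDegRel R I E M (e0 + ∑ j ∈ Finset.range r, (r - 1).choose j * v j)

section RepresentingCocycles

open CategoryTheory Limits Opposite

variable {R : Type} [CommRing R] {ι : Type} {c : ComplexShape ι}

/-- For a complex in the opposite of a module category, `IsRep K n f a` says that the cocycle `f`
represents the cohomology class `a`. -/
def IsRep (K : HomologicalComplex (ModuleCat.{0} R)ᵒᵖ c) (n : ι)
    (f : (K.X n).unop) (a : (K.homology n).unop) : Prop :=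
  ∃ z : (K.opcycles n).unop, (K.pOpcycles n).unop.hom z = f ∧ (K.homologyι n).unop.hom z = a

variable {K L : HomologicalComplex (ModuleCat.{0} R)ᵒᵖ c} {n : ι}

lemma pOpcycles_unop_injective : Function.Injective (K.pOpcycles n).unop.hom :=
  (ModuleCat.mono_iff_injective _).1 inferInstance

lemma homologyι_unop_surjective : Function.Surjective (K.homologyι n).unop.hom :=
  (ModuleCat.epi_iff_surjective _).1 inferInstance

lemma IsRep.unique {f : (K.X n).unop} {a b : (K.homology n).unop} (ha : IsRep K n f a)
    (hb : IsRep K n f b) : a = b := by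
  obtain ⟨z, h1, rfl⟩ := ha
  obtain ⟨w, h2, rfl⟩ := hb
  rw [pOpcycles_unop_injective (h1.trans h2.symm)]

lemma IsRep.add {f g : (K.X n).unop} {a b : (K.homology n).unop} (ha : IsRep K n f a)
    (hb : IsRep K n g b) : IsRep K n (f + g) (a + b) := by
  obtain ⟨z, rfl, rfl⟩ := ha
  obtain ⟨w, rfl, rfl⟩ := hb
  exact ⟨z + w, map_add _ _ _, map_add _ _ _⟩

lemma IsRep.smul {f : (K.X n).unop} {a : (K.homology n).unop} (ha : IsRep K n f a) (r : R) :
    IsRep K n (r • f) (r • a) := by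
  obtain ⟨z, rfl, rfl⟩ := ha
  exact ⟨r • z, map_smul _ _ _, map_smul _ _ _⟩

lemma IsRep.map {f : (L.X n).unop} {a : (L.homology n).unop} (ha : IsRep L n f a) (φ : K ⟶ L) :
    IsRep K n ((φ.f n).unop.hom f) ((HomologicalComplex.homologyMap φ n).unop.hom a) := by
  obtain ⟨z, rfl, rfl⟩ := ha
  refine ⟨(HomologicalComplex.opcyclesMap φ n).unop.hom z, ?_, ?_⟩
  · have := congrArg (fun q => q.unop.hom z) (HomologicalComplex.p_opcyclesMap φ n)
    exact this
  · have := congrArg (fun q => q.unop.hom z) (HomologicalComplex.homologyι_naturality φ n)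
    exact this.symm

lemma isRep_surjective (a : (K.homology n).unop) : ∃ f, IsRep K n f a := by
  obtain ⟨z, rfl⟩ := homologyι_unop_surjective a
  exact ⟨_, z, rfl, rfl⟩

lemma exact_unop_apply {S : ShortComplex (ModuleCat.{0} R)ᵒᵖ} (hS : S.Exact) (x : S.X₂.unop)
    (hx : S.f.unop.hom x = 0) : ∃ y : S.X₃.unop, S.g.unop.hom y = x := by
  have := (ShortComplex.moduleCat_exact_iff _).1 hS.unop
  exact this x hx

lemma isRep_iff_cocycle {i : ι} (hi : c.prev n = i) (f : (K.X n).unop) :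
    (∃ a, IsRep K n f a) ↔ (K.d i n).unop.hom f = 0 := by
  constructor
  · rintro ⟨_, z, rfl, rfl⟩
    have := congrArg (fun q => q.unop.hom z) (K.d_pOpcycles i n)
    exact this
  · intro hf
    have hS : (ShortComplex.mk (K.d i n) (K.pOpcycles n) (K.d_pOpcycles i n)).Exact :=
      ShortComplex.exact_of_g_is_cokernel _ (K.opcyclesIsCokernel i n hi)
    obtain ⟨z, hz⟩ := exact_unop_apply hS f hf
    exact ⟨_, z, hz, rfl⟩

lemma isRep_zero_iff {j : ι} (hj : c.next n = j) (f : (K.X n).unop) :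
    IsRep K n f 0 ↔ ∃ g : (K.X j).unop, (K.d n j).unop.hom g = f := by
  have hS : (ShortComplex.mk (K.homologyι n) (K.fromOpcycles n j)
      (K.homologyι_comp_fromOpcycles n j)).Exact :=
    ShortComplex.exact_of_f_is_kernel _ (K.homologyIsKernel n j hj)
  constructor
  · rintro ⟨z, rfl, hz⟩
    obtain ⟨g, rfl⟩ := exact_unop_apply hS z hz
    refine ⟨g, ?_⟩
    have := congrArg (fun q => q.unop.hom g) (K.p_fromOpcycles n j)
    exact this.symm
  · rintro ⟨g, rfl⟩
    refine ⟨(K.fromOpcycles n j).unop.hom g, ?_, ?_⟩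
    · have := congrArg (fun q => q.unop.hom g) (K.p_fromOpcycles n j)
      exact this
    · have := congrArg (fun q => q.unop.hom g) (K.homologyι_comp_fromOpcycles n j)
      exact this

end RepresentingCocycles

section CompareExt

open CategoryTheory Limits Opposite

variable {R : Type} [CommRing R]

/-- The complex, in the opposite category, whose homology is the derived-functor `Ext`. -/
noncomputable abbrev homComplex (P : ChainComplex (ModuleCat.{0} R) ℕ) (Y : ModuleCat.{0} R) :
    HomologicalComplex (ModuleCat.{0} R)ᵒᵖ (ComplexShape.down ℕ) :=
  (((linearYoneda R (ModuleCat.{0} R)).obj Y).rightOp.mapHomologicalComplex _).obj P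

variable {X Y : ModuleCat.{0} R} (P : ProjectiveResolution X) (n : ℕ)

lemma extMk_smul (f : P.complex.X n ⟶ Y) (hf : P.complex.d (n + 1) n ≫ f = 0) (r : R) :
    P.extMk (r • f) (n + 1) rfl (by simp [hf]) = r • P.extMk f (n + 1) rfl hf := by
  rw [Abelian.Ext.smul_eq_comp_mk₀, ProjectiveResolution.extMk_comp_mk₀]
  congr 1

lemma extMk_eq_zero_iff_exists (f : P.complex.X n ⟶ Y)
    (hf : P.complex.d (n + 1) n ≫ f = 0) :
    P.extMk f (n + 1) rfl hf = 0 ↔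
      ∃ g : P.complex.X ((ComplexShape.down ℕ).next n) ⟶ Y, P.complex.d n _ ≫ g = f := by
  cases n with
  | succ n =>
    have : (ComplexShape.down ℕ).next (n + 1) = n := by simp
    rw [this]
    exact P.extMk_eq_zero_iff f _ rfl hf n rfl
  | zero =>
    have key : P.extMk f 1 rfl hf = 0 ↔ f = 0 := by
      rw [← P.extEquivCohomologyClass.apply_eq_iff_eq,
        ProjectiveResolution.extEquivCohomologyClass_extMk,
        ProjectiveResolution.extEquivCohomologyClass_zero,
        CochainComplex.HomComplex.CohomologyClass.mk_eq_zero_iff]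
      rw [CochainComplex.HomComplex.Cocycle.toSingleMk_mem_coboundaries_iff _ _ _ _ _ 1 (by simp)]
      have hz : IsZero (P.cochainComplex.X 1) :=
        P.cochainComplex.isZero_of_isStrictlyLE 0 1 (by simp)
      constructor
      · rintro ⟨g, hg⟩
        have : g = 0 := hz.eq_of_src _ _
        subst this
        rw [← cancel_epi (P.cochainComplexXIso (-((0:ℕ):ℤ)) 0 rfl).hom]
        simpa using hg.symm
      · rintro rfl
        exact ⟨0, by simp⟩
    rw [key]
    have h : ¬ (ComplexShape.down ℕ).Rel 0 ((ComplexShape.down ℕ).next 0) := by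
      simp
    rw [P.complex.shape _ _ h]
    simp [eq_comm]

/-- `IsExtRep P n f a` says that the cocycle `f : Pₙ ⟶ Y` represents the class `a`. -/
def IsExtRep (f : P.complex.X n ⟶ Y) (a : ((homComplex P.complex Y).homology n).unop) : Prop :=
  IsRep (homComplex P.complex Y) n f a

variable {P n}

lemma isExtRep_surjective (a : ((homComplex P.complex Y).homology n).unop) :
    ∃ f, IsExtRep P n f a :=
  isRep_surjective a

lemma IsExtRep.add {f g : P.complex.X n ⟶ Y} {a b} (h : IsExtRep P n f a)
    (h' : IsExtRep P n g b) : IsExtRep P n (f + g) (a + b) :=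
  IsRep.add h h'

lemma IsExtRep.smul {f : P.complex.X n ⟶ Y} {a} (h : IsExtRep P n f a) (r : R) :
    IsExtRep P n (r • f) (r • a) :=
  IsRep.smul h r

lemma IsExtRep.sub {f g : P.complex.X n ⟶ Y} {a b} (h : IsExtRep P n f a)
    (h' : IsExtRep P n g b) : IsExtRep P n (f - g) (a - b) := by
  simpa [sub_eq_add_neg] using h.add (h'.smul (-1))

lemma IsExtRep.unique {f : P.complex.X n ⟶ Y} {a b} (h : IsExtRep P n f a)
    (h' : IsExtRep P n f b) : a = b :=
  IsRep.unique h h'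

lemma exists_isExtRep_iff (f : P.complex.X n ⟶ Y) :
    (∃ a, IsExtRep P n f a) ↔ P.complex.d (n + 1) n ≫ f = 0 :=
  isRep_iff_cocycle (by simp) _

lemma IsExtRep.cocycle {f : P.complex.X n ⟶ Y} {a} (h : IsExtRep P n f a) :
    P.complex.d (n + 1) n ≫ f = 0 :=
  (exists_isExtRep_iff f).1 ⟨a, h⟩

lemma isExtRep_zero_iff_extMk (f : P.complex.X n ⟶ Y) (hf : P.complex.d (n + 1) n ≫ f = 0) :
    IsExtRep P n f 0 ↔ P.extMk f (n + 1) rfl hf = 0 := by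
  rw [extMk_eq_zero_iff_exists]
  exact isRep_zero_iff rfl _

lemma IsExtRep.extMk_eq {f g : P.complex.X n ⟶ Y} {a} (h : IsExtRep P n f a)
    (h' : IsExtRep P n g a) :
    P.extMk f (n + 1) rfl h.cocycle = P.extMk g (n + 1) rfl h'.cocycle := by
  rw [← sub_eq_zero, P.sub_extMk, ← isExtRep_zero_iff_extMk]
  simpa using h.sub h'

variable (P n)

/-- Cohomology of `Hom(P, Y)` for a projective resolution `P` of `X` is `Ext(X, Y)`. -/
noncomputable def homologyToExt :
    ((homComplex P.complex Y).homology n).unop →ₗ[R] Abelian.Ext X Y n where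
  toFun a := P.extMk (isExtRep_surjective a).choose (n + 1) rfl
    (isExtRep_surjective a).choose_spec.cocycle
  map_add' a b := by
    rw [P.add_extMk]
    exact IsExtRep.extMk_eq (isExtRep_surjective (a + b)).choose_spec
      ((isExtRep_surjective a).choose_spec.add (isExtRep_surjective b).choose_spec)
  map_smul' r a := by
    dsimp only [RingHom.id_apply]
    rw [← extMk_smul]
    exact IsExtRep.extMk_eq (isExtRep_surjective (r • a)).choose_spec
      ((isExtRep_surjective a).choose_spec.smul r)

lemma homologyToExt_eq {f : P.complex.X n ⟶ Y} {a} (h : IsExtRep P n f a) :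
    homologyToExt P n a = P.extMk f (n + 1) rfl h.cocycle :=
  IsExtRep.extMk_eq (isExtRep_surjective a).choose_spec h

lemma homologyToExt_bijective :
    Function.Bijective (homologyToExt (Y := Y) P n) := by
  constructor
  · rw [injective_iff_map_eq_zero]
    intro a ha
    obtain ⟨f, hf⟩ := isExtRep_surjective a
    rw [homologyToExt_eq P n hf, ← isExtRep_zero_iff_extMk] at ha
    exact hf.unique ha
  · intro b
    obtain ⟨f, hf, rfl⟩ := P.extMk_surjective b (n + 1) rfl
    obtain ⟨a, ha⟩ := (exists_isExtRep_iff f).2 hf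
    exact ⟨a, homologyToExt_eq P n ha⟩

lemma homologyToExt_naturality {X' : ModuleCat.{0} R} {P' : ProjectiveResolution X'} {g : X' ⟶ X}
    (φ : ProjectiveResolution.Hom P' P g) (a : ((homComplex P.complex Y).homology n).unop) :
    homologyToExt P' n ((HomologicalComplex.homologyMap
      ((((linearYoneda R (ModuleCat.{0} R)).obj Y).rightOp.mapHomologicalComplex _).map φ.hom)
        n).unop.hom a) =
      (Abelian.Ext.mk₀ g).comp (homologyToExt P n a) (zero_add n) := by
  obtain ⟨f, hf⟩ := isExtRep_surjective a
  rw [homologyToExt_eq P n hf, ProjectiveResolution.mk₀_comp_extMk f _ rfl hf.cocycle φ]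
  exact homologyToExt_eq P' n (f := φ.hom.f n ≫ f) (IsRep.map hf
    ((((linearYoneda R (ModuleCat.{0} R)).obj Y).rightOp.mapHomologicalComplex _).map φ.hom))

/-- The derived-functor `Ext` agrees with `Abelian.Ext`. -/
noncomputable def extEquiv (X Y : ModuleCat.{0} R) (n : ℕ) :
    ((Ext R (ModuleCat.{0} R) n).obj (op X)).obj Y ≃ₗ[R] Abelian.Ext X Y n :=
  (((projectiveResolution X).isoLeftDerivedObj
    ((linearYoneda R (ModuleCat.{0} R)).obj Y).rightOp n).unop.symm.toLinearEquiv).trans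
  (LinearEquiv.ofBijective _ (homologyToExt_bijective (projectiveResolution X) n))

lemma extEquiv_naturality {X X' : ModuleCat.{0} R} (g : X' ⟶ X) (Y : ModuleCat.{0} R) (n : ℕ)
    (a : ((Ext R (ModuleCat.{0} R) n).obj (op X)).obj Y) :
    extEquiv X' Y n ((((Ext R (ModuleCat.{0} R) n).map g.op).app Y).hom a) =
      (Abelian.Ext.mk₀ g).comp (extEquiv X Y n a) (zero_add n) := by
  let P := projectiveResolution X
  let P' := projectiveResolution X'
  let ψ := ProjectiveResolution.lift g P' P
  have hψ : ψ ≫ P.π = P'.π ≫ (ChainComplex.single₀ _).map g :=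
    ProjectiveResolution.lift_commutes g P' P
  let φ : ProjectiveResolution.Hom P' P g :=
    { hom := ψ
      hom_f_zero_comp_π_f_zero := by
        have := congrArg (fun q => HomologicalComplex.Hom.f q 0) hψ
        simpa using this }
  refine Eq.trans ?_ (homologyToExt_naturality P n φ _)
  refine congrArg (homologyToExt P' n) ?_
  have := ProjectiveResolution.isoLeftDerivedObj_inv_naturality g P' P ψ
    φ.hom_f_zero_comp_π_f_zero ((linearYoneda R (ModuleCat.{0} R)).obj Y).rightOp n
  exact congrArg (fun q => q.unop.hom a) this

end CompareExt

section LocalCohomologyDirectLimit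

open CategoryTheory Limits Opposite

variable {R : Type} [CommRing R] (J : Ideal R)

/-- The module `R / J ^ t`. -/
abbrev quotPow (t : ℕ) : ModuleCat.{0} R := ModuleCat.of R (R ⧸ J ^ t)

/-- The projection `R / J ^ s ⟶ R / J ^ t` for `t ≤ s`. -/
noncomputable def quotPowMap {t s : ℕ} (h : t ≤ s) : quotPow J s ⟶ quotPow J t :=
  ModuleCat.ofHom (Submodule.mapQ (J ^ s) (J ^ t) LinearMap.id (Ideal.pow_le_pow_right h))

lemma quotPowMap_comp {t s u : ℕ} (h : t ≤ s) (h' : s ≤ u) :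
    quotPowMap J h' ≫ quotPowMap J h = quotPowMap J (h.trans h') := by
  refine ModuleCat.hom_ext (LinearMap.ext fun x => ?_)
  obtain ⟨x, rfl⟩ := Submodule.Quotient.mk_surjective _ x
  rfl

lemma quotPowMap_refl (t : ℕ) : quotPowMap J (le_refl t) = 𝟙 _ := by
  refine ModuleCat.hom_ext (LinearMap.ext fun x => ?_)
  obtain ⟨x, rfl⟩ := Submodule.Quotient.mk_surjective _ x
  rfl

/-- The transition maps of the system `Ext (R / J ^ t, X)`. -/
noncomputable def extTrans (X : ModuleCat.{0} R) (j : ℕ) (t s : ℕ) (h : t ≤ s) :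
    Abelian.Ext (quotPow J t) X j →ₗ[R] Abelian.Ext (quotPow J s) X j where
  toFun a := (Abelian.Ext.mk₀ (quotPowMap J h)).comp a (zero_add j)
  map_add' a b := by simp
  map_smul' r a := by simp

lemma extTrans_apply (X : ModuleCat.{0} R) (j : ℕ) {t s : ℕ} (h : t ≤ s)
    (a : Abelian.Ext (quotPow J t) X j) :
    extTrans J X j t s h a = (Abelian.Ext.mk₀ (quotPowMap J h)).comp a (zero_add j) := rfl

instance (X : ModuleCat.{0} R) (j : ℕ) :
    DirectedSystem (fun t => Abelian.Ext (quotPow J t) X j) (extTrans J X j · · ·) where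
  map_self t a := by simp [extTrans_apply, quotPowMap_refl]
  map_map {t s u} h h' a := by
    rw [extTrans_apply, extTrans_apply, extTrans_apply, ← quotPowMap_comp J h h',
      ← Abelian.Ext.mk₀_comp_mk₀, Abelian.Ext.comp_assoc _ _ _ (add_zero _) (zero_add j) (by simp)]

/-- Local cohomology as a direct limit of `Abelian.Ext`. -/
abbrev LimExt (X : ModuleCat.{0} R) (j : ℕ) : Type :=
  Module.DirectLimit (fun t => Abelian.Ext (quotPow J t) X j) (extTrans J X j)

/-- The diagram defining `localCohomology`, evaluated at a module. -/
noncomputable abbrev lcDiagram (X : ModuleCat.{0} R) (j : ℕ) : ℕᵒᵖᵒᵖ ⥤ ModuleCat.{0} R :=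
  localCohomology.diagram (localCohomology.idealPowersDiagram J) j ⋙
    (evaluation _ _).obj X

/-- The structure map to the direct limit. -/
noncomputable def toLimExt (X : ModuleCat.{0} R) (j : ℕ) (t : ℕ) :
    (lcDiagram J X j).obj (op (op t)) →ₗ[R] LimExt J X j :=
  Module.DirectLimit.of R ℕ (fun t => Abelian.Ext (quotPow J t) X j) (extTrans J X j) t ∘ₗ
    (extEquiv (quotPow J t) X j).toLinearMap

lemma extEquiv_lcDiagram_map (X : ModuleCat.{0} R) (j : ℕ) {t s : ℕᵒᵖᵒᵖ} (w : t ⟶ s)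
    (a : (lcDiagram J X j).obj t) :
    extEquiv (quotPow J s.unop.unop) X j (((lcDiagram J X j).map w).hom a) =
      extTrans J X j t.unop.unop s.unop.unop (leOfHom w.unop.unop)
        (extEquiv (quotPow J t.unop.unop) X j a) :=
  extEquiv_naturality (quotPowMap J (leOfHom w.unop.unop)) X j a

/-- The cocone exhibiting `LimExt` as a colimit. -/
noncomputable def limExtCocone (X : ModuleCat.{0} R) (j : ℕ) : Cocone (lcDiagram J X j) where
  pt := ModuleCat.of R (LimExt J X j)
  ι :=
    { app := fun t => ModuleCat.ofHom (toLimExt J X j t.unop.unop)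
      naturality := fun t s w => by
        ext a
        have := extEquiv_lcDiagram_map J X j w a
        change Module.DirectLimit.of R ℕ _ (extTrans J X j) s.unop.unop
          (extEquiv (quotPow J s.unop.unop) X j (((lcDiagram J X j).map w).hom a)) =
          Module.DirectLimit.of R ℕ _ (extTrans J X j) t.unop.unop
            (extEquiv (quotPow J t.unop.unop) X j a)
        rw [this, Module.DirectLimit.of_f] }

/-- The map out of `LimExt` induced by a cocone. -/
noncomputable def limExtDesc (X : ModuleCat.{0} R) (j : ℕ) (s : Cocone (lcDiagram J X j)) :
    LimExt J X j →ₗ[R] s.pt :=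
  Module.DirectLimit.lift R ℕ _ (extTrans J X j)
    (fun t => (s.ι.app (op (op t))).hom ∘ₗ (extEquiv (quotPow J t) X j).symm.toLinearMap)
    (fun t u h a => by
      obtain ⟨a, rfl⟩ := (extEquiv (quotPow J t) X j).surjective a
      have h1 := extEquiv_lcDiagram_map J X j (t := op (op t)) (s := op (op u))
        (homOfLE h).op.op a
      have h2 := congrArg (fun q => q.hom a) (s.w (j := op (op u)) (j' := op (op t))
        (homOfLE h).op.op)
      change (s.ι.app (op (op u))).hom ((extEquiv (quotPow J u) X j).symm
        (extTrans J X j t u h _)) = (s.ι.app (op (op t))).hom ((extEquiv (quotPow J t) X j).symm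
          (extEquiv (quotPow J t) X j a))
      rw [LinearEquiv.symm_apply_apply, ← h2]
      refine congrArg (s.ι.app (op (op u))).hom ?_
      exact (LinearEquiv.symm_apply_eq _).2 h1.symm)

lemma limExtDesc_toLimExt (X : ModuleCat.{0} R) (j : ℕ) (s : Cocone (lcDiagram J X j)) (t : ℕ)
    (a : (lcDiagram J X j).obj (op (op t))) :
    limExtDesc J X j s (toLimExt J X j t a) = (s.ι.app (op (op t))).hom a := by
  refine (Module.DirectLimit.lift_of _ _ _).trans ?_
  exact congrArg (s.ι.app (op (op t))).hom
    ((extEquiv (quotPow J t) X j).symm_apply_apply a)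

/-- `LimExt` is the colimit of the diagram defining local cohomology. -/
noncomputable def isColimitLimExtCocone (X : ModuleCat.{0} R) (j : ℕ) :
    IsColimit (limExtCocone J X j) where
  desc s := ModuleCat.ofHom (limExtDesc J X j s)
  fac s t := ModuleCat.hom_ext (LinearMap.ext fun a =>
    limExtDesc_toLimExt J X j s t.unop.unop a)
  uniq s m hm := by
    refine ModuleCat.hom_ext (Module.DirectLimit.hom_ext fun t => LinearMap.ext fun a => ?_)
    obtain ⟨a, rfl⟩ := (extEquiv (quotPow J t) X j).surjective a
    exact (congrArg (fun q => q.hom a) (hm (op (op t)))).trans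
      (limExtDesc_toLimExt J X j s t a).symm

/-- Local cohomology is the direct limit of the modules `Ext (R / J ^ t, X)`. -/
noncomputable def localCohomologyEquiv (X : ModuleCat.{0} R) (j : ℕ) :
    (localCohomology J j).obj X ≃ₗ[R] LimExt J X j :=
  ((colimitObjIsoColimitCompEvaluation
      (localCohomology.diagram (localCohomology.idealPowersDiagram J) j) X).trans
    ((colimit.isColimit (lcDiagram J X j)).coconePointUniqueUpToIso
      (isColimitLimExtCocone J X j))).toLinearEquiv

end LocalCohomologyDirectLimit

section LimExtFunctoriality

open CategoryTheory Limits Opposite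

variable {R : Type} [CommRing R] (J : Ideal R)

/-- The elements of `X` killed by a power of `J`. -/
def powTorsion (X : Type) [AddCommGroup X] [Module R X] : Submodule R X where
  carrier := {x | ∃ n : ℕ, ∀ r ∈ J ^ n, r • x = 0}
  zero_mem' := ⟨0, by simp⟩
  add_mem' := by
    rintro x y ⟨n, hn⟩ ⟨k, hk⟩
    exact ⟨n + k, fun r hr => by
      rw [smul_add, hn r (Ideal.pow_le_pow_right (by omega) hr),
        hk r (Ideal.pow_le_pow_right (by omega) hr), add_zero]⟩
  smul_mem' := by
    rintro c x ⟨n, hn⟩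
    exact ⟨n, fun r hr => by rw [smul_comm, hn r hr, smul_zero]⟩

variable {X Y Z : ModuleCat.{0} R}

/-- Postcomposition by an `Ext` class, on `LimExt`. -/
noncomputable def limComp {i k l : ℕ} (b : Abelian.Ext X Y k) (h : i + k = l) :
    LimExt J X i →ₗ[R] LimExt J Y l :=
  Module.DirectLimit.map
    (fun t => { toFun := fun a => a.comp b h
                map_add' := fun a a' => by simp
                map_smul' := fun r a => by simp })
    (fun t s hts => by
      ext a
      exact Abelian.Ext.comp_assoc _ _ _ (zero_add i) h (by simpa))

/-- The structure map to `LimExt`. -/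
noncomputable abbrev limOf (X : ModuleCat.{0} R) (i t : ℕ) :
    Abelian.Ext (quotPow J t) X i →ₗ[R] LimExt J X i :=
  Module.DirectLimit.of R ℕ (fun t => Abelian.Ext (quotPow J t) X i) (extTrans J X i) t

lemma limComp_limOf {i k l : ℕ} (b : Abelian.Ext X Y k) (h : i + k = l) (t : ℕ)
    (a : Abelian.Ext (quotPow J t) X i) :
    limComp J b h (limOf J X i t a) = limOf J Y l t (a.comp b h) :=
  Module.DirectLimit.map_apply_of _ _ _

lemma limComp_mk₀_comp {i l p : ℕ} (f : X ⟶ Y)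
    (c : Abelian.Ext Y Z p) (h' : i + p = l) (z : LimExt J X i) :
    limComp J c h' (limComp J (Abelian.Ext.mk₀ f) (add_zero i) z) =
      limComp J ((Abelian.Ext.mk₀ f).comp c (zero_add p)) h' z := by
  obtain ⟨t, a, rfl⟩ := Module.DirectLimit.exists_of z
  rw [limComp_limOf, limComp_limOf, limComp_limOf,
    Abelian.Ext.comp_assoc _ _ _ (add_zero i) (zero_add p) (by omega)]

lemma limComp_comp_mk₀ {i l p : ℕ} (c : Abelian.Ext X Y p) (h' : i + p = l) (f : Y ⟶ Z)
    (z : LimExt J X i) :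
    limComp J (Abelian.Ext.mk₀ f) (add_zero l) (limComp J c h' z) =
      limComp J (c.comp (Abelian.Ext.mk₀ f) (add_zero p)) h' z := by
  obtain ⟨t, a, rfl⟩ := Module.DirectLimit.exists_of z
  rw [limComp_limOf, limComp_limOf, limComp_limOf,
    Abelian.Ext.comp_assoc _ _ _ h' (add_zero p) (by omega)]

lemma limComp_zero {i k l : ℕ} (h : i + k = l) (z : LimExt J X i) :
    limComp J (0 : Abelian.Ext X Y k) h z = 0 := by
  obtain ⟨t, a, rfl⟩ := Module.DirectLimit.exists_of z
  rw [limComp_limOf, Abelian.Ext.comp_zero, map_zero]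

lemma limComp_smul_id {i : ℕ} (r : R) (z : LimExt J X i) :
    limComp J (Abelian.Ext.mk₀ (r • 𝟙 X)) (add_zero i) z = r • z := by
  obtain ⟨t, a, rfl⟩ := Module.DirectLimit.exists_of z
  rw [limComp_limOf, ← Abelian.Ext.smul_eq_comp_mk₀, map_smul]

/-- Exactness passes to the limit. -/
lemma limComp_exact {i k l p q : ℕ} (b : Abelian.Ext X Y k) (h : i + k = l)
    (c : Abelian.Ext Y Z p) (h' : l + p = q)
    (H : ∀ t (a : Abelian.Ext (quotPow J t) Y l), a.comp c h' = 0 →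
      ∃ a' : Abelian.Ext (quotPow J t) X i, a'.comp b h = a)
    (z : LimExt J Y l) (hz : limComp J c h' z = 0) : ∃ w, limComp J b h w = z := by
  obtain ⟨t, a, rfl⟩ := Module.DirectLimit.exists_of z
  rw [limComp_limOf] at hz
  obtain ⟨s, hs, h0⟩ := Module.DirectLimit.of.zero_exact hz
  obtain ⟨a', ha'⟩ := H s (extTrans J Y l t s hs a) (by
    rw [← h0, extTrans_apply, extTrans_apply]
    exact Abelian.Ext.comp_assoc _ _ _ (zero_add l) h' (by omega))
  refine ⟨limOf J X i s a', ?_⟩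
  rw [limComp_limOf, ha', Module.DirectLimit.of_f]

variable {S : ShortComplex (ModuleCat.{0} R)} (hS : S.ShortExact)

lemma limExt_exact₁ {i l : ℕ} (h : i + 1 = l) (z : LimExt J S.X₁ l)
    (hz : limComp J (Abelian.Ext.mk₀ S.f) (add_zero l) z = 0) :
    ∃ w, limComp J hS.extClass h w = z :=
  limComp_exact J _ _ _ _ (fun _ a ha => Abelian.Ext.covariant_sequence_exact₁ _ hS a ha h) z hz

include hS in
lemma limExt_exact₂ {l : ℕ} (z : LimExt J S.X₂ l)
    (hz : limComp J (Abelian.Ext.mk₀ S.g) (add_zero l) z = 0) :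
    ∃ w, limComp J (Abelian.Ext.mk₀ S.f) (add_zero l) w = z :=
  limComp_exact J _ _ _ _ (fun _ a ha => Abelian.Ext.covariant_sequence_exact₂ _ hS a ha) z hz

lemma limExt_exact₃ {i l : ℕ} (h : i + 1 = l) (z : LimExt J S.X₃ i)
    (hz : limComp J hS.extClass h z = 0) :
    ∃ w, limComp J (Abelian.Ext.mk₀ S.g) (add_zero i) w = z :=
  limComp_exact J _ _ _ _ (fun _ a ha => Abelian.Ext.covariant_sequence_exact₃ _ hS a h ha) z hz

lemma limComp_extClass_mk₀ {i l : ℕ} (h : i + 1 = l) (z : LimExt J S.X₃ i) :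
    limComp J (Abelian.Ext.mk₀ S.f) (add_zero l) (limComp J hS.extClass h z) = 0 := by
  rw [limComp_comp_mk₀, hS.extClass_comp, limComp_zero]

lemma limComp_mk₀_extClass {i l : ℕ} (h : i + 1 = l) (z : LimExt J S.X₂ i) :
    limComp J hS.extClass h (limComp J (Abelian.Ext.mk₀ S.g) (add_zero i) z) = 0 := by
  rw [limComp_mk₀_comp, hS.comp_extClass, limComp_zero]

/-- Every element of `LimExt` is killed by a power of the ideal. -/
lemma limExt_torsion {i : ℕ} (z : LimExt J X i) : ∃ n : ℕ, ∀ r ∈ J ^ n, r • z = 0 := by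
  obtain ⟨t, a, rfl⟩ := Module.DirectLimit.exists_of z
  refine ⟨t, fun r hr => ?_⟩
  have h0 : r • 𝟙 (quotPow J t) = 0 := by
    refine ModuleCat.hom_ext (LinearMap.ext fun x => ?_)
    obtain ⟨x, rfl⟩ := Submodule.Quotient.mk_surjective _ x
    change r • Submodule.Quotient.mk x = (0 : R ⧸ J ^ t)
    rw [← Submodule.Quotient.mk_smul, Submodule.Quotient.mk_eq_zero]
    exact Ideal.mul_mem_right _ _ hr
  have h1 : r • a = 0 := by
    have := Abelian.Ext.smul_comp (Abelian.Ext.mk₀ (𝟙 (quotPow J t))) a (zero_add i) r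
    rw [← Abelian.Ext.mk₀_smul, h0, Abelian.Ext.mk₀_zero, Abelian.Ext.zero_comp,
      Abelian.Ext.mk₀_id_comp] at this
    exact this.symm
  rw [← map_smul, h1, map_zero]

/-- Evaluation at `1` of a degree zero class. -/
noncomputable def extEval (X : ModuleCat.{0} R) (t : ℕ) :
    Abelian.Ext (quotPow J t) X 0 →ₗ[R] X :=
  (LinearMap.applyₗ (R := R) (Submodule.Quotient.mk (p := J ^ t) (1 : R))) ∘ₗ
    (Abelian.Ext.linearEquiv₀.trans ModuleCat.homLinearEquiv).toLinearMap

lemma extEval_mk₀ (t : ℕ) (f : quotPow J t ⟶ X) :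
    extEval J X t (Abelian.Ext.mk₀ f) = f.hom (Submodule.Quotient.mk (p := J ^ t) (1 : R)) := by
  have : Abelian.Ext.linearEquiv₀ (R := R) (Abelian.Ext.mk₀ f) = f := by
    apply Abelian.Ext.mk₀_bijective _ _ |>.1
    rw [Abelian.Ext.mk₀_linearEquiv₀_apply]
  change (Abelian.Ext.linearEquiv₀ (R := R) (Abelian.Ext.mk₀ f)).hom _ = _
  rw [this]

lemma exists_mk₀ (t : ℕ) (a : Abelian.Ext (quotPow J t) X 0) :
    ∃ f, Abelian.Ext.mk₀ f = a :=
  (Abelian.Ext.mk₀_bijective _ _).2 a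

lemma extEval_injective (t : ℕ) : Function.Injective (extEval J X t) := by
  rw [injective_iff_map_eq_zero]
  intro a ha
  obtain ⟨f, rfl⟩ := exists_mk₀ J t a
  rw [extEval_mk₀] at ha
  have : f = 0 := by
    refine ModuleCat.hom_ext (LinearMap.ext fun x => ?_)
    obtain ⟨x, rfl⟩ := Submodule.Quotient.mk_surjective _ x
    have hx : (Submodule.Quotient.mk x : R ⧸ J ^ t) = x • Submodule.Quotient.mk 1 := by
      rw [← Submodule.Quotient.mk_smul, smul_eq_mul, mul_one]
    change f.hom (Submodule.Quotient.mk x : R ⧸ J ^ t) = 0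
    rw [hx, map_smul, ha, smul_zero]
  rw [this, Abelian.Ext.mk₀_zero]

/-- Evaluation at `1`, on the limit. -/
noncomputable def limEval (X : ModuleCat.{0} R) : LimExt J X 0 →ₗ[R] X :=
  Module.DirectLimit.lift R ℕ _ (extTrans J X 0) (extEval J X) (fun t s h a => by
    obtain ⟨f, rfl⟩ := exists_mk₀ J t a
    rw [extTrans_apply, Abelian.Ext.mk₀_comp_mk₀, extEval_mk₀, extEval_mk₀]
    rfl)

lemma limEval_limOf (t : ℕ) (a : Abelian.Ext (quotPow J t) X 0) :
    limEval J X (limOf J X 0 t a) = extEval J X t a :=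
  Module.DirectLimit.lift_of _ _ _

lemma limEval_injective : Function.Injective (limEval J X) :=
  Module.DirectLimit.lift_injective _ _ (extEval_injective J)

lemma limEval_range : LinearMap.range (limEval J X) = powTorsion J X := by
  apply le_antisymm
  · rintro _ ⟨z, rfl⟩
    obtain ⟨n, hn⟩ := limExt_torsion J z
    exact ⟨n, fun r hr => by rw [← map_smul, hn r hr, map_zero]⟩
  · rintro x ⟨n, hn⟩
    let f : quotPow J n ⟶ X := ModuleCat.ofHom (Submodule.liftQ (J ^ n)
      (LinearMap.toSpanSingleton R X x) (fun r hr => hn r hr))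
    refine ⟨limOf J X 0 n (Abelian.Ext.mk₀ f), ?_⟩
    rw [limEval_limOf, extEval_mk₀]
    exact one_smul R x

lemma limEval_limComp (f : X ⟶ Y) (z : LimExt J X 0) :
    limEval J Y (limComp J (Abelian.Ext.mk₀ f) (add_zero 0) z) = f.hom (limEval J X z) := by
  obtain ⟨t, a, rfl⟩ := Module.DirectLimit.exists_of z
  obtain ⟨g, rfl⟩ := exists_mk₀ J t a
  rw [limComp_limOf, limEval_limOf, limEval_limOf, Abelian.Ext.mk₀_comp_mk₀, extEval_mk₀,
    extEval_mk₀]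
  rfl

end LimExtFunctoriality

section TorsionVanishing

open CategoryTheory Limits Opposite

variable {R : Type} [CommRing R] (J : Ideal R)

/-- Short exact sequences of modules, from linear maps. -/
lemma shortExact_ofHom {A B C : Type} [AddCommGroup A] [Module R A] [AddCommGroup B] [Module R B]
    [AddCommGroup C] [Module R C] (f : A →ₗ[R] B) (g : B →ₗ[R] C) (hf : Function.Injective f)
    (hfg : Function.Exact f g) (hg : Function.Surjective g) :
    (ShortComplex.mk (ModuleCat.ofHom f) (ModuleCat.ofHom g)
      (ModuleCat.hom_ext hfg.linearMap_comp_eq_zero)).ShortExact where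
  exact := (ShortComplex.ShortExact.moduleCat_exact_iff_function_exact _).2 hfg
  mono_f := (ModuleCat.mono_iff_injective _).2 hf
  epi_g := (ModuleCat.epi_iff_surjective _).2 hg

/-- The torsion part of an injective module over a Noetherian ring is injective. -/
lemma powTorsion_injective [IsNoetherianRing R] (I : Type) [AddCommGroup I] [Module R I]
    [hI : Module.Injective R I] : Module.Injective R (powTorsion J I) := by
  refine Module.Baer.injective fun 𝔞 f => ?_
  obtain ⟨n, hn⟩ : ∃ n : ℕ, ∀ r ∈ J ^ n, ∀ x : 𝔞, r • f x = 0 := by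
    obtain ⟨s, hs⟩ := (IsNoetherian.noetherian (⊤ : Submodule R 𝔞))
    choose k hk using fun x : 𝔞 => (f x).2
    refine ⟨s.sup k, fun r hr x => ?_⟩
    have hx : x ∈ Submodule.span R (s : Set 𝔞) := hs ▸ Submodule.mem_top
    induction hx using Submodule.span_induction with
    | mem x hx =>
      exact Subtype.ext (hk x r (Ideal.pow_le_pow_right (Finset.le_sup hx) hr))
    | zero => simp
    | add x y _ _ hx hy => rw [map_add, smul_add, hx, hy, add_zero]
    | smul c x _ hx => rw [map_smul, smul_comm, hx, smul_zero]
  obtain ⟨k, hk⟩ := Ideal.exists_pow_inf_eq_pow_smul J (M := R) 𝔞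
  have hAR : ∀ x (hx : x ∈ 𝔞), x ∈ J ^ (n + k) → f ⟨x, hx⟩ = 0 := by
    intro x hx hxJ
    have h1 : x ∈ J ^ n • (𝔞 : Submodule R R) := by
      have := (hk (n + k) (by omega)).le ⟨by simpa using hxJ, hx⟩
      rw [Nat.add_sub_cancel] at this
      exact Submodule.smul_mono le_rfl inf_le_right this
    have h2 : ∀ y ∈ J ^ n • (𝔞 : Submodule R R), ∃ hy : y ∈ 𝔞, f ⟨y, hy⟩ = 0 := by
      intro y hy
      induction hy using Submodule.smul_induction_on' with
      | smul r hr z hz =>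
        refine ⟨𝔞.smul_mem r hz, ?_⟩
        rw [← hn r hr ⟨z, hz⟩, ← map_smul]
        rfl
      | add y hy z hz h h' =>
        obtain ⟨a, ha⟩ := h
        obtain ⟨b, hb⟩ := h'
        refine ⟨𝔞.add_mem a b, ?_⟩
        have : (⟨y + z, 𝔞.add_mem a b⟩ : 𝔞) = ⟨y, a⟩ + ⟨z, b⟩ := rfl
        rw [this, map_add, ha, hb, add_zero]
    exact (h2 x h1).2
  let c : Submodule R 𝔞 := Submodule.comap 𝔞.subtype (J ^ (n + k))
  let i : (𝔞 ⧸ c) →ₗ[R] (R ⧸ J ^ (n + k)) := Submodule.mapQ c (J ^ (n + k)) 𝔞.subtype le_rfl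
  have hi : Function.Injective i := by
    rw [← LinearMap.ker_eq_bot, Submodule.ker_mapQ, Submodule.mkQ_map_self]
  let g : (𝔞 ⧸ c) →ₗ[R] I := Submodule.liftQ c ((powTorsion J I).subtype ∘ₗ f)
    (fun x hx => by
      change ((f x : powTorsion J I) : I) = 0
      rw [hAR x x.2 hx]
      rfl)
  obtain ⟨φ, hφ⟩ := hI.out i hi g
  refine ⟨LinearMap.codRestrict (powTorsion J I) (φ ∘ₗ (Submodule.mkQ (J ^ (n + k))))
    (fun r => ⟨n + k, fun s hs => ?_⟩), fun x hx => Subtype.ext ?_⟩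
  · rw [← map_smul]
    have : s • r ∈ J ^ (n + k) := Ideal.mul_mem_right _ _ hs
    rw [LinearMap.comp_apply, Submodule.mkQ_apply, (Submodule.Quotient.mk_eq_zero _).2 this,
      map_zero]
  · exact hφ (Submodule.Quotient.mk ⟨x, hx⟩)

/-- Torsion modules embed into torsion injective modules. -/
lemma exists_torsion_injective [IsNoetherianRing R] (K : Type) [AddCommGroup K] [Module R K]
    (hK : powTorsion J K = ⊤) : ∃ (I : Type) (_ : AddCommGroup I) (_ : Module R I)
      (f : K →ₗ[R] I), Injective (ModuleCat.of R I) ∧ Function.Injective f ∧ powTorsion J I = ⊤ := by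
  let I₀ : ModuleCat.{0} R := Injective.under (ModuleCat.of R K)
  have : Injective (ModuleCat.of R I₀) := inferInstanceAs (Injective (Injective.under _))
  have : Module.Injective R I₀ := Module.injective_module_of_injective_object R I₀
  let f₀ : K →ₗ[R] I₀ := (Injective.ι (ModuleCat.of R K)).hom
  have hf₀ : Function.Injective f₀ := (ModuleCat.mono_iff_injective _).1 inferInstance
  have := powTorsion_injective J I₀
  refine ⟨powTorsion J I₀, inferInstance, inferInstance, LinearMap.codRestrict _ f₀ (fun x => ?_),
    Module.injective_object_of_injective_module R _, ?_, ?_⟩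
  · obtain ⟨n, hn⟩ := hK.ge (Submodule.mem_top (x := x))
    exact ⟨n, fun r hr => by rw [← map_smul, hn r hr, map_zero]⟩
  · intro x y h
    exact hf₀ (congrArg Subtype.val h)
  · rw [eq_top_iff]
    rintro ⟨x, n, hn⟩ -
    exact ⟨n, fun r hr => Subtype.ext (hn r hr)⟩

/-- `LimExt` of a torsion module vanishes in positive degrees. -/
lemma limExt_eq_zero_of_torsion [IsNoetherianRing R] (j : ℕ) :
    ∀ (K : Type) [AddCommGroup K] [Module R K], powTorsion J K = ⊤ →
      ∀ z : LimExt J (ModuleCat.of R K) (j + 1), z = 0 := by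
  induction j with
  | zero =>
    intro K _ _ hK z
    obtain ⟨I, _, _, f, hI, hf, hIt⟩ := exists_torsion_injective J K hK
    have hS := shortExact_ofHom f (LinearMap.range f).mkQ hf
      (LinearMap.exact_iff.2 (Submodule.ker_mkQ _)) (Submodule.mkQ_surjective _)
    have hz : limComp J (Abelian.Ext.mk₀ (ModuleCat.ofHom f)) (add_zero 1) z = 0 := by
      obtain ⟨t, a, rfl⟩ := Module.DirectLimit.exists_of z
      rw [limComp_limOf]
      have := @Abelian.Ext.eq_zero_of_injective _ _ _ _ _ _ _ hI
        (a.comp (Abelian.Ext.mk₀ (ModuleCat.ofHom f)) (add_zero 1))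
      exact (congrArg _ this).trans (map_zero _)
    obtain ⟨w, rfl⟩ := limExt_exact₁ J hS (zero_add 1) z hz
    obtain ⟨y, hy⟩ := Submodule.mkQ_surjective _ (limEval J _ w)
    have hy' : y ∈ LinearMap.range (limEval J (ModuleCat.of R I)) := by
      rw [limEval_range, hIt]; exact Submodule.mem_top
    obtain ⟨v, rfl⟩ := hy'
    have : w = limComp J (Abelian.Ext.mk₀ (ModuleCat.ofHom (LinearMap.range f).mkQ))
        (add_zero 0) v := by
      apply limEval_injective J
      rw [limEval_limComp]
      exact hy.symm
    rw [this]
    exact limComp_mk₀_extClass J hS (zero_add 1) v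
  | succ j ih =>
    intro K _ _ hK z
    obtain ⟨I, _, _, f, hI, hf, hIt⟩ := exists_torsion_injective J K hK
    have hS := shortExact_ofHom f (LinearMap.range f).mkQ hf
      (LinearMap.exact_iff.2 (Submodule.ker_mkQ _)) (Submodule.mkQ_surjective _)
    have hz : limComp J (Abelian.Ext.mk₀ (ModuleCat.ofHom f)) (add_zero (j + 1 + 1)) z = 0 := by
      obtain ⟨t, a, rfl⟩ := Module.DirectLimit.exists_of z
      rw [limComp_limOf]
      have := @Abelian.Ext.eq_zero_of_injective _ _ _ _ _ _ _ hI
        (a.comp (Abelian.Ext.mk₀ (ModuleCat.ofHom f)) (add_zero (j + 1 + 1)))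
      exact (congrArg _ this).trans (map_zero _)
    obtain ⟨w, rfl⟩ := limExt_exact₁ J hS rfl z hz
    have : w = 0 := ih (I ⧸ LinearMap.range f) (by
      rw [eq_top_iff]
      rintro x -
      obtain ⟨y, rfl⟩ := Submodule.mkQ_surjective _ x
      obtain ⟨n, hn⟩ := hIt.ge (Submodule.mem_top (x := y))
      exact ⟨n, fun r hr => by rw [← map_smul, hn r hr, map_zero]⟩) w
    rw [this, map_zero]

end TorsionVanishing

section LocalCohomologySequence

open CategoryTheory Limits Opposite

/-- The quotient `X / hX`. -/
abbrev QMul {R : Type} [CommRing R] (h : R) (X : Type) [AddCommGroup X] [Module R X] : Type :=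
  X ⧸ LinearMap.range (LinearMap.lsmul R X h)

variable {R : Type} [CommRing R] (J : Ideal R)

variable {A B C : Type} [AddCommGroup A] [Module R A] [AddCommGroup B] [Module R B]
  [AddCommGroup C] [Module R C]

/-- The map on `LimExt` induced by a linear map. -/
noncomputable def limExtMap (f : A →ₗ[R] B) (j : ℕ) :
    LimExt J (ModuleCat.of R A) j →ₗ[R] LimExt J (ModuleCat.of R B) j :=
  limComp J (Abelian.Ext.mk₀ (ModuleCat.ofHom f)) (add_zero j)

lemma limExtMap_limExtMap (f : A →ₗ[R] B) (g : B →ₗ[R] C) (j : ℕ)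
    (z : LimExt J (ModuleCat.of R A) j) : limExtMap J g j (limExtMap J f j z) = limExtMap J (g ∘ₗ f) j z := by
  unfold limExtMap
  rw [limComp_mk₀_comp, Abelian.Ext.mk₀_comp_mk₀]
  rfl

lemma limExtMap_smul_id (r : R) (j : ℕ) (z : LimExt J (ModuleCat.of R A) j) :
    limExtMap J (LinearMap.lsmul R A r) j z = r • z :=
  limComp_smul_id J r z

lemma limExtMap_zero (j : ℕ) (z : LimExt J (ModuleCat.of R A) j) :
    limExtMap J (0 : A →ₗ[R] B) j z = 0 := by
  have : ModuleCat.ofHom (0 : A →ₗ[R] B) = 0 := rfl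
  unfold limExtMap
  rw [this, Abelian.Ext.mk₀_zero, limComp_zero]

lemma limExtMap_exact {f : A →ₗ[R] B} {g : B →ₗ[R] C} (hf : Function.Injective f)
    (hfg : Function.Exact f g) (hg : Function.Surjective g) (j : ℕ)
    (z : LimExt J (ModuleCat.of R B) j) (hz : limExtMap J g j z = 0) :
    ∃ w, limExtMap J f j w = z :=
  limExt_exact₂ J (shortExact_ofHom f g hf hfg hg) z hz

lemma exists_connecting_aux {S : ShortComplex (ModuleCat.{0} R)} (hS : S.ShortExact) {j l : ℕ}
    (h : j + 1 = l) :
    ∃ δ : LimExt J S.X₃ j →ₗ[R] LimExt J S.X₁ l,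
      (∀ z, (∃ y, δ y = z) ↔ limComp J (Abelian.Ext.mk₀ S.f) (add_zero l) z = 0) ∧
      (∀ y, δ y = 0 ↔ ∃ x, limComp J (Abelian.Ext.mk₀ S.g) (add_zero j) x = y) := by
  refine ⟨limComp J hS.extClass h, fun z => ⟨?_, fun hz => ?_⟩, fun y => ⟨fun hy => ?_, ?_⟩⟩
  · rintro ⟨y, hy⟩
    rw [← hy]
    exact limComp_extClass_mk₀ J hS h y
  · exact limExt_exact₁ J hS h z hz
  · exact limExt_exact₃ J hS h y hy
  · rintro ⟨x, hx⟩
    rw [← hx]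
    exact limComp_mk₀_extClass J hS h x

lemma exists_connecting {f : A →ₗ[R] B} {g : B →ₗ[R] C} (hf : Function.Injective f)
    (hfg : Function.Exact f g) (hg : Function.Surjective g) (j : ℕ) :
    ∃ δ : LimExt J (ModuleCat.of R C) j →ₗ[R] LimExt J (ModuleCat.of R A) (j + 1),
      (∀ z, (∃ y, δ y = z) ↔ limExtMap J f (j + 1) z = 0) ∧
      (∀ y, δ y = 0 ↔ ∃ x, limExtMap J g j x = y) :=
  exists_connecting_aux J (shortExact_ofHom f g hf hfg hg) rfl

/-- If multiplication by `h` on `X` has `J`-torsion kernel, it induces a long exact sequence. -/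
lemma limExt_mul_sequence [IsNoetherianRing R] (X : Type) [AddCommGroup X] [Module R X] (h : R)
    (hX : ∀ x : X, h • x = 0 → x ∈ powTorsion J X) (j : ℕ) :
    ∃ (α : LimExt J (ModuleCat.of R (QMul h X)) j →ₗ[R] LimExt J (ModuleCat.of R X) (j + 1))
      (β : LimExt J (ModuleCat.of R X) j →ₗ[R] LimExt J (ModuleCat.of R (QMul h X)) j),
      (∀ z, (∃ y, α y = z) ↔ h • z = 0) ∧ (∀ y, α y = 0 ↔ ∃ x, β x = y) ∧
        ∀ x, β (h • x) = 0 := by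
  let μ : X →ₗ[R] X := LinearMap.lsmul R X h
  let p : X →ₗ[R] LinearMap.range μ := μ.rangeRestrict
  let i : LinearMap.range μ →ₗ[R] X := (LinearMap.range μ).subtype
  let q : X →ₗ[R] QMul h X := (LinearMap.range μ).mkQ
  have e₁ : Function.Exact (LinearMap.ker μ).subtype p :=
    LinearMap.exact_iff.2 (by rw [LinearMap.ker_rangeRestrict, Submodule.range_subtype])
  have e₂ : Function.Exact i q :=
    LinearMap.exact_iff.2 (by rw [Submodule.ker_mkQ, Submodule.range_subtype])
  have hp : Function.Surjective p := μ.surjective_rangeRestrict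
  have hq : Function.Surjective q := Submodule.mkQ_surjective _
  have hK : powTorsion J (LinearMap.ker μ) = ⊤ := by
    rw [eq_top_iff]
    rintro ⟨x, hx⟩ -
    obtain ⟨n, hn⟩ := hX x hx
    exact ⟨n, fun r hr => Subtype.ext (hn r hr)⟩
  have h0 := fun j => limExt_eq_zero_of_torsion J j (LinearMap.ker μ) hK
  have hμ : ∀ (j : ℕ) (z : LimExt J (ModuleCat.of R X) j),
      limExtMap J i j (limExtMap J p j z) = h • z := by
    intro j z
    rw [limExtMap_limExtMap, ← limExtMap_smul_id]
    rfl
  have hP : Function.Bijective (limExtMap J p (j + 1)) := by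
    constructor
    · rw [injective_iff_map_eq_zero]
      intro z hz
      obtain ⟨w, rfl⟩ := limExtMap_exact J Subtype.val_injective e₁ hp _ z hz
      rw [h0 j w, map_zero]
    · intro z
      obtain ⟨δ, -, hδ⟩ := exists_connecting J Subtype.val_injective e₁ hp (j + 1)
      exact (hδ z).1 (h0 (j + 1) _)
  let e := LinearEquiv.ofBijective _ hP
  obtain ⟨δ, hδ₁, hδ₂⟩ := exists_connecting J Subtype.val_injective e₂ hq j
  have hα : ∀ y z, (e.symm.toLinearMap ∘ₗ δ) y = z ↔ δ y = limExtMap J p (j + 1) z := fun y z =>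
    e.symm_apply_eq
  refine ⟨e.symm.toLinearMap ∘ₗ δ, limExtMap J q j, fun z => ?_, fun y => ?_, fun x => ?_⟩
  · simp only [hα]
    rw [← hμ (j + 1) z]
    exact hδ₁ _
  · rw [hα, map_zero]
    exact hδ₂ _
  · have hqi : q ∘ₗ i = 0 := LinearMap.ext fun x => (Submodule.Quotient.mk_eq_zero _).2 x.2
    rw [← hμ j x, limExtMap_limExtMap, hqi, limExtMap_zero]

variable [IsLocalRing R]

/-- Local cohomology as a direct limit of `Ext`. -/
noncomputable def lcEquiv (j : ℕ) (X : Type) [AddCommGroup X] [Module R X] :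
    LC R j X ≃ₗ[R] LimExt (maximalIdeal R) (ModuleCat.of R X) j :=
  localCohomologyEquiv (maximalIdeal R) (ModuleCat.of R X) j

/-- The long exact sequence of local cohomology for multiplication by `h`. -/
theorem lc_mul_sequence [IsNoetherianRing R] (X : Type) [AddCommGroup X] [Module R X] (h : R)
    (hX : ∀ x : X, h • x = 0 → x ∈ powTorsion (maximalIdeal R) X) (j : ℕ) :
    ∃ (α : LC R j (QMul h X) →ₗ[R] LC R (j + 1) X) (β : LC R j X →ₗ[R] LC R j (QMul h X)),
      (∀ z, (∃ y, α y = z) ↔ h • z = 0) ∧ (∀ y, α y = 0 ↔ ∃ x, β x = y) ∧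
        ∀ x, β (h • x) = 0 := by
  obtain ⟨α, β, h1, h2, h3⟩ := limExt_mul_sequence (maximalIdeal R) X h hX j
  let e := lcEquiv (R := R) j X
  let e' := lcEquiv (R := R) j (QMul h X)
  let f := lcEquiv (R := R) (j + 1) X
  refine ⟨f.symm.toLinearMap ∘ₗ α ∘ₗ e'.toLinearMap, e'.symm.toLinearMap ∘ₗ β ∘ₗ e.toLinearMap,
    fun z => ?_, fun y => ?_, fun x => ?_⟩
  · have hz : h • f z = 0 ↔ h • z = 0 := by rw [← map_smul, f.map_eq_zero_iff]
    rw [← hz, ← h1 (f z)]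
    constructor
    · rintro ⟨y, hy⟩
      exact ⟨e' y, f.symm_apply_eq.1 hy⟩
    · rintro ⟨y, hy⟩
      exact ⟨e'.symm y, f.symm_apply_eq.2 ((congrArg α (e'.apply_symm_apply y)).trans hy)⟩
  · refine (f.symm_apply_eq.trans ?_)
    rw [map_zero]
    refine (h2 (e' y)).trans ?_
    constructor
    · rintro ⟨x, hx⟩
      refine ⟨e.symm x, e'.symm_apply_eq.2 ((congrArg β (e.apply_symm_apply x)).trans hx)⟩
    · rintro ⟨x, hx⟩
      exact ⟨e x, e'.symm_apply_eq.1 hx⟩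
  · refine (e'.symm_apply_eq.2 ?_)
    rw [map_zero, ← h3 (e x), ← map_smul]
    rfl

/-- Local cohomology modules are torsion. -/
theorem lc_torsion (X : Type) [AddCommGroup X] [Module R X] (j : ℕ) (z : LC R j X) :
    z ∈ powTorsion (maximalIdeal R) (LC R j X) := by
  let e := lcEquiv (R := R) j X
  obtain ⟨n, hn⟩ := limExt_torsion (maximalIdeal R) (e z)
  exact ⟨n, fun r hr => e.injective ((map_smul e r z).trans ((hn r hr).trans (map_zero e).symm))⟩

/-- The zeroth local cohomology is the torsion submodule. -/
theorem lc_zero_equiv (X : Type) [AddCommGroup X] [Module R X] :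
    Nonempty (LC R 0 X ≃ₗ[R] powTorsion (maximalIdeal R) X) :=
  ⟨(lcEquiv (R := R) 0 X).trans
    ((LinearEquiv.ofInjective _ (limEval_injective (maximalIdeal R))).trans
      (LinearEquiv.ofEq _ _ (limEval_range (maximalIdeal R))))⟩

end LocalCohomologySequence

section MatlisDual

variable {R : Type} [CommRing R]

/-- The dual of an exact sequence into an injective module is exact. -/
lemma exists_comp_eq_of_exact {E B C : Type} [AddCommGroup E] [Module R E] [Module.Injective R E]
    [AddCommGroup B] [Module R B] [AddCommGroup C] [Module R C]
    (v : B →ₗ[R] C) (φ : B →ₗ[R] E) (h : ∀ b, v b = 0 → φ b = 0) : ∃ ψ : C →ₗ[R] E, ψ ∘ₗ v = φ := by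
  let i : (B ⧸ LinearMap.ker v) →ₗ[R] C := (LinearMap.ker v).liftQ v le_rfl
  have hi : Function.Injective i := by
    rw [← LinearMap.ker_eq_bot]
    exact Submodule.ker_liftQ_eq_bot _ _ _ le_rfl
  obtain ⟨ψ, hψ⟩ := Module.Injective.out i hi ((LinearMap.ker v).liftQ φ h)
  exact ⟨ψ, LinearMap.ext fun b => hψ (Submodule.Quotient.mk b)⟩

variable [IsLocalRing R]

lemma exists_dual_ne_zero {E : Type} [AddCommGroup E] [Module R E] (hE : IsInjEnvResidue R E)
    {K : Type} [AddCommGroup K] [Module R K] {x : K} (hx : x ≠ 0) : ∃ φ : K →ₗ[R] E, φ x ≠ 0 := by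
  obtain ⟨hinj, ι, hι, -⟩ := hE
  let s : R →ₗ[R] K := LinearMap.toSpanSingleton R K x
  obtain ⟨ψ, hψ⟩ := exists_comp_eq_of_exact s (ι ∘ₗ (maximalIdeal R).mkQ) (fun b hb => by
    have : b ∈ maximalIdeal R := by
      rw [mem_maximalIdeal]
      intro hu
      exact hx ((hu.smul_eq_zero).1 hb)
    rw [LinearMap.comp_apply, Submodule.mkQ_apply, (Submodule.Quotient.mk_eq_zero _).2 this,
      map_zero])
  refine ⟨ψ, fun h0 => ?_⟩
  have h1 : ι (Submodule.Quotient.mk (1 : R)) = 0 := by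
    have := LinearMap.congr_fun hψ 1
    refine this.symm.trans ?_
    change ψ ((1 : R) • x) = 0
    rw [one_smul, h0]
  have h2 := hι (h1.trans (map_zero ι).symm)
  rw [Submodule.Quotient.mk_eq_zero] at h2
  exact (Ideal.ne_top_iff_one _).1 (maximalIdeal.isMaximal R).ne_top h2

/-- The length of a module is at most that of its Matlis dual. -/
lemma length_le_length_dual {E : Type} [AddCommGroup E] [Module R E] (hE : IsInjEnvResidue R E)
    (K : Type) [AddCommGroup K] [Module R K] :
    Module.length R K ≤ Module.length R (K →ₗ[R] E) := by
  rw [← WithBot.coe_le_coe, Module.coe_length, Module.coe_length, ← Order.krullDim_orderDual]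
  let F : (Submodule R K)ᵒᵈ → Submodule R (K →ₗ[R] E) := fun N =>
    { carrier := {φ | ∀ x ∈ OrderDual.ofDual N, φ x = 0}
      zero_mem' := fun _ _ => rfl
      add_mem' := fun {φ ψ} h h' x hx => by rw [LinearMap.add_apply, h x hx, h' x hx, add_zero]
      smul_mem' := fun c φ h x hx => by rw [LinearMap.smul_apply, h x hx, smul_zero] }
  refine Order.krullDim_le_of_strictMono F fun N N' h => ?_
  obtain ⟨hle, x, hx, hx'⟩ := SetLike.lt_iff_le_and_exists.1 (OrderDual.ofDual_lt_ofDual.2 h)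
  refine SetLike.lt_iff_le_and_exists.2 ⟨fun φ hφ y hy => hφ y (hle hy), ?_⟩
  obtain ⟨φ, hφ⟩ := exists_dual_ne_zero hE (K := K ⧸ OrderDual.ofDual N')
    (x := Submodule.Quotient.mk x) (fun h => hx' ((Submodule.Quotient.mk_eq_zero _).1 h))
  refine ⟨φ ∘ₗ Submodule.mkQ _, fun y hy => ?_, fun h => hφ (h x hx)⟩
  rw [LinearMap.comp_apply, Submodule.mkQ_apply, (Submodule.Quotient.mk_eq_zero _).2 hy, map_zero]

/-- The Matlis dual of local cohomology. -/
abbrev LCDual (R : Type) [CommRing R] [IsLocalRing R] (E : Type) [AddCommGroup E] [Module R E] (j : ℕ)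
    (X : Type) [AddCommGroup X] [Module R X] : Type := LC R j X →ₗ[R] E

/-- The sequence relating the dual local cohomology of `X` and `X / hX`. -/
lemma lcDual_mul_sequence [IsNoetherianRing R] {E : Type} [AddCommGroup E] [Module R E]
    [Module.Injective R E] (X : Type) [AddCommGroup X] [Module R X] (h : R)
    (hX : ∀ x : X, h • x = 0 → x ∈ powTorsion (maximalIdeal R) X) (j : ℕ) :
    ∃ (f : LCDual R E (j + 1) X →ₗ[R] LCDual R E j (QMul h X))
      (g : LCDual R E j (QMul h X) →ₗ[R] LCDual R E j X),
      (∀ φ, f φ = 0 ↔ ∃ ψ : LCDual R E (j + 1) X, h • ψ = φ) ∧ (∀ ψ, g ψ = 0 ↔ ∃ φ, f φ = ψ) ∧ ∀ ψ, h • g ψ = 0 := by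
  obtain ⟨α, β, h1, h2, h3⟩ := lc_mul_sequence X h hX j
  refine ⟨LinearMap.lcomp R E α, LinearMap.lcomp R E β, fun φ => ⟨fun hφ => ?_, ?_⟩,
    fun ψ => ⟨fun hψ => ?_, ?_⟩, fun ψ => LinearMap.ext fun x => ?_⟩
  · obtain ⟨ψ, hψ⟩ := exists_comp_eq_of_exact (LinearMap.lsmul R (LC R (j + 1) X) h) φ
      (fun b hb => by
        obtain ⟨y, rfl⟩ := (h1 b).2 hb
        exact LinearMap.congr_fun hφ y)
    refine ⟨ψ, LinearMap.ext fun b => ?_⟩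
    have := LinearMap.congr_fun hψ b
    exact (map_smul ψ h b).symm.trans this
  · rintro ⟨ψ, rfl⟩
    refine LinearMap.ext fun y => ?_
    exact (map_smul ψ h (α y)).symm.trans ((congrArg ψ ((h1 _).1 ⟨y, rfl⟩)).trans (map_zero ψ))
  · obtain ⟨φ, hφ⟩ := exists_comp_eq_of_exact α ψ (fun y hy => by
      obtain ⟨x, rfl⟩ := (h2 y).1 hy
      exact LinearMap.congr_fun hψ x)
    exact ⟨φ, hφ⟩
  · rintro ⟨φ, rfl⟩
    refine LinearMap.ext fun x => ?_
    exact (congrArg φ ((h2 _).2 ⟨x, rfl⟩)).trans (map_zero φ)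
  · exact (map_smul ψ h (β x)).symm.trans
      ((congrArg ψ ((map_smul β h x).symm.trans (h3 x))).trans (map_zero ψ))

end MatlisDual

section CompleteNakayama

variable {R : Type} [CommRing R]

lemma mLength_eq_coe_iff {X : Type} [AddCommGroup X] [Module R X] {l : ℕ} :
    mLength R X = (l : ℕ∞) ↔ Module.length R X = l := by
  rw [mLength, ← Module.coe_length]
  exact WithBot.coe_inj

lemma finite_of_length_ne_top {X : Type} [AddCommGroup X] [Module R X]
    (h : Module.length R X ≠ ⊤) : Module.Finite R X := by
  have := (isFiniteLength_iff_isNoetherian_isArtinian.1 (Module.length_ne_top_iff.1 h)).1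
  infer_instance

lemma isPrecomplete_pi (I : Ideal R) [IsPrecomplete I R] (n : ℕ) : IsPrecomplete I (Fin n → R) := by
  refine AdicCompletion.of_surjective_iff.1 fun x => ?_
  choose y hy using fun j => AdicCompletion.of_surjective I R
    (AdicCompletion.piEquivOfFintype I (fun _ : Fin n => R) x j)
  refine ⟨y, (AdicCompletion.piEquivOfFintype I (fun _ : Fin n => R)).injective (funext fun j => ?_)⟩
  rw [← hy j]
  exact AdicCompletion.map_of I (LinearMap.proj (R := R) (φ := fun _ : Fin n => R) j) y

variable [IsLocalRing R]

lemma finite_of_isHausdorff [IsAdicComplete (maximalIdeal R) R] (X : Type) [AddCommGroup X]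
    [Module R X] [IsHausdorff (maximalIdeal R) X] {I : Ideal R} (hI : I ≤ maximalIdeal R)
    (h : Module.Finite R (X ⧸ (I • ⊤ : Submodule R X))) : Module.Finite R X := by
  let p : (X ⧸ (I • ⊤ : Submodule R X)) →ₗ[R] (X ⧸ (maximalIdeal R • ⊤ : Submodule R X)) :=
    Submodule.factor (Submodule.smul_mono_left hI)
  have hp : Function.Surjective p := Submodule.factor_surjective _
  have := Module.Finite.of_surjective p hp
  obtain ⟨n, f, hf⟩ := Module.Finite.exists_fin' R (X ⧸ (maximalIdeal R • ⊤ : Submodule R X))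
  obtain ⟨g, hg⟩ := Module.projective_lifting_property
    (Submodule.mkQ (maximalIdeal R • ⊤ : Submodule R X)) f (Submodule.mkQ_surjective _)
  have := isPrecomplete_pi (maximalIdeal R) n
  refine Module.Finite.of_surjective g (surjective_of_mkQ_comp_surjective (I := maximalIdeal R) ?_)
  rw [hg]
  exact hf

lemma isHausdorff_lcDual (E : Type) [AddCommGroup E] [Module R E] (j : ℕ)
    (X : Type) [AddCommGroup X] [Module R X] : IsHausdorff (maximalIdeal R) (LCDual R E j X) where
  haus' φ hφ := by
    refine LinearMap.ext fun z => ?_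
    obtain ⟨n, hn⟩ := lc_torsion X j z
    have h := hφ n
    rw [SModEq.zero] at h
    revert h
    generalize φ = ψ
    intro h
    induction h using Submodule.smul_induction_on' with
    | smul r hr ψ _ => exact (map_smul ψ r z).symm.trans ((congrArg ψ (hn r hr)).trans (map_zero ψ))
    | add ψ _ ψ' _ h h' => rw [LinearMap.add_apply, h, h']; exact add_zero _

lemma HDegRel.finite [IsAdicComplete (maximalIdeal R) R] {Q : Ideal R} (hQ : Q ≤ maximalIdeal R)
    {E : Type} [AddCommGroup E] [Module R E] {X : ModuleCat R} {v : ℕ} (h : HDegRel R Q E X v)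
    (hX : IsHausdorff (maximalIdeal R) X) : Module.Finite R X := by
  cases h with
  | base _ _ _ hl =>
    rw [mLength_eq_coe_iff] at hl
    exact finite_of_length_ne_top (hl ▸ ENat.natCast_ne_top _)
  | step _ r _ _ e e0 he _ _ _ =>
    obtain ⟨N, hN⟩ := he
    obtain ⟨l, hl, -⟩ := hN N le_rfl
    rw [mLength_eq_coe_iff] at hl
    refine finite_of_isHausdorff X ((Ideal.pow_le_self (Nat.succ_ne_zero N)).trans hQ)
      (finite_of_length_ne_top (hl ▸ ENat.natCast_ne_top _))

end CompleteNakayama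

section GenericElements

variable {R : Type} [CommRing R]

/-- Generic elements of `Q`: those outside finitely many ideals properly contained in `Q`. -/
def genericFilter (Q : Ideal R) : Filter R where
  sets := {S | ∃ F : Finset (Ideal R), (∀ L ∈ F, L < Q) ∧ ∀ h ∈ Q, (∀ L ∈ F, h ∉ L) → h ∈ S}
  univ_sets := ⟨∅, by simp, by simp⟩
  sets_of_superset := fun ⟨F, hF, hS⟩ hST => ⟨F, hF, fun h hh hL => hST (hS h hh hL)⟩
  inter_sets := by
    classical
    rintro S T ⟨F, hF, hS⟩ ⟨G, hG, hT⟩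
    refine ⟨F ∪ G, fun L hL => (Finset.mem_union.1 hL).elim (hF L) (hG L), fun h hh hL => ⟨?_, ?_⟩⟩
    · exact hS h hh fun L hL' => hL L (Finset.mem_union_left _ hL')
    · exact hT h hh fun L hL' => hL L (Finset.mem_union_right _ hL')

lemma eventually_genericFilter_mem (Q : Ideal R) : ∀ᶠ h in genericFilter Q, h ∈ Q :=
  ⟨∅, by simp, fun _ hh _ => hh⟩

lemma eventually_genericFilter_of_finite {Q : Ideal R} {T : Set (Ideal R)} (hT : T.Finite) :
    ∀ᶠ h in genericFilter Q, ∀ P ∈ T, h ∈ P → Q ≤ P := by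
  classical
  refine ⟨(hT.toFinset.image (· ⊓ Q)).filter (· < Q), by simp, fun h hh hL P hP hhP => ?_⟩
  by_contra hQP
  refine hL (P ⊓ Q) (Finset.mem_filter.2 ⟨Finset.mem_image_of_mem _ (hT.mem_toFinset.2 hP), ?_⟩)
    ⟨hhP, hh⟩
  exact lt_of_le_of_ne inf_le_right fun h => hQP (inf_eq_right.1 h)

lemma genericFilter_neBot [IsLocalRing R] [IsNoetherianRing R] [Infinite (ResidueField R)]
    (Q : Ideal R) : (genericFilter Q).NeBot := by
  rw [Filter.neBot_iff, Ne, ← Filter.empty_mem_iff_bot]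
  rintro ⟨F, hF, hS⟩
  have hcov : ⋃ L ∈ F, (Submodule.comap (Submodule.subtype Q) L : Set Q) = Set.univ := by
    rw [Set.eq_univ_iff_forall]
    intro ⟨x, hx⟩
    by_contra hc
    refine hS x hx fun L hL hxL => hc (Set.mem_iUnion₂.2 ⟨L, hL, hxL⟩)
  obtain ⟨L, hL, hfin⟩ := Submodule.exists_finiteIndex_of_cover hcov
  have hne : Submodule.comap (Submodule.subtype Q) L ≠ ⊤ := by
    rw [Ne, Submodule.comap_subtype_eq_top]
    exact (hF L hL).not_ge
  obtain ⟨L', hL', hle⟩ := (eq_top_or_exists_le_coatom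
    (Submodule.comap (Submodule.subtype Q) L)).resolve_left hne
  have : Finite (Q ⧸ Submodule.comap (Submodule.subtype Q) L) :=
    AddSubgroup.finite_quotient_of_finiteIndex
  have : Finite (Q ⧸ L') := Finite.of_surjective _ (Submodule.factor_surjective hle)
  obtain ⟨I, hI, ⟨eq⟩⟩ := isSimpleModule_iff_quot_maximal.1 (isSimpleModule_iff_isCoatom.2 hL')
  obtain rfl := eq_maximalIdeal hI
  have : Finite (ResidueField R) := Finite.of_equiv _ eq.toEquiv
  exact not_finite (ResidueField R)

/-- If every associated prime of `X` containing `a` contains `J`, then the kernel of `a` is killed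
by a power of `J`. -/
lemma exists_pow_smul_eq_zero_of_associatedPrimes {A X : Type*} [CommRing A] [IsNoetherianRing A]
    [AddCommGroup X] [Module A X] [Module.Finite A X] {J : Ideal A} {a : A}
    (h : ∀ P ∈ associatedPrimes A X, a ∈ P → J ≤ P) :
    ∃ N : ℕ, ∀ x : X, a • x = 0 → ∀ b ∈ J ^ N, b • x = 0 := by
  let W : Submodule A X := LinearMap.ker (LinearMap.lsmul A X a)
  have hrad : J ≤ (Module.annihilator A W).radical := by
    intro b hb
    let K : ℕ →o Submodule A X :=
      { toFun := fun n => LinearMap.ker (LinearMap.lsmul A X (b ^ n))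
        monotone' := fun n k hnk x hx => by
          rw [LinearMap.mem_ker, LinearMap.lsmul_apply] at hx ⊢
          rw [← Nat.sub_add_cancel hnk, pow_add, mul_smul, hx, smul_zero] }
    obtain ⟨n, hn⟩ := monotone_stabilizes_iff_noetherian.2 (inferInstanceAs (IsNoetherian A X)) K
    refine ⟨n, Module.mem_annihilator.2 fun ⟨w, hw⟩ => Subtype.ext ?_⟩
    by_contra hne
    let V : Submodule A X := Submodule.span A {b ^ n • w}
    have hVn : Nontrivial V := (Submodule.nontrivial_iff_ne_bot).2 fun h => hne <| by
      rw [Submodule.span_singleton_eq_bot] at h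
      exact h
    obtain ⟨P, hP⟩ := associatedPrimes.nonempty A V
    have hPX := associatedPrimes.subset_of_injective (f := V.subtype) Subtype.val_injective hP
    obtain ⟨hprime, ⟨x, hx⟩, hPx⟩ := (isAssociatedPrime_iff).1 hP
    obtain ⟨c, rfl⟩ := Submodule.mem_span_singleton.1 hx
    have hmem : ∀ d, d ∈ P ↔ d • (c • b ^ n • w) = 0 := by
      intro d
      rw [hPx, Submodule.mem_colon_singleton, Submodule.mem_bot, ← Subtype.coe_inj]
      rfl
    have haw : a • w = 0 := hw
    have ha : a ∈ P := by
      rw [hmem, smul_comm a c, smul_comm a (b ^ n), haw, smul_zero, smul_zero]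
    have hbP := (hmem b).1 (h P hPX ha hb)
    have h1 : c • w ∈ K (n + 1) := by
      change b ^ (n + 1) • c • w = 0
      rw [pow_succ', mul_smul, smul_comm (b ^ n) c]
      exact hbP
    rw [← hn (n + 1) (Nat.le_succ n)] at h1
    have h2 : c • b ^ n • w = 0 := by
      rw [smul_comm]
      exact h1
    exact hprime.ne_top ((Ideal.eq_top_iff_one _).2 ((hmem 1).2 (by rw [h2, smul_zero])))
  obtain ⟨N, hN⟩ := Ideal.exists_pow_le_of_le_radical_of_fg hrad (IsNoetherian.noetherian J)
  refine ⟨N, fun x hx b hb => ?_⟩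
  exact congrArg Subtype.val (Module.mem_annihilator.1 (hN hb) ⟨x, hx⟩)

lemma eventually_exists_pow_smul_eq_zero [IsNoetherianRing R] (Q : Ideal R) (X : Type)
    [AddCommGroup X] [Module R X] [Module.Finite R X] :
    ∀ᶠ h in genericFilter Q, ∃ N : ℕ, ∀ x : X, h • x = 0 → ∀ b ∈ Q ^ N, b • x = 0 := by
  filter_upwards [eventually_genericFilter_of_finite (Q := Q) (associatedPrimes.finite R X)]
    with h hh
  exact exists_pow_smul_eq_zero_of_associatedPrimes hh

end GenericElements

section Superficial

open Polynomial

variable {R : Type} [CommRing R]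

/-- The degree one part of the Rees algebra. -/
noncomputable def reesDegreeOne (Q : Ideal R) : Q →ₗ[R] reesAlgebra Q where
  toFun q := ⟨monomial 1 (q : R), reesAlgebra.monomial_mem.2 (by simp)⟩
  map_add' p q := Subtype.ext (by simp)
  map_smul' r q := Subtype.ext (by simp [smul_monomial])

lemma monomial_mem_pow_reesDegreeOne (Q : Ideal R) (m : ℕ) {b : R} (hb : b ∈ Q ^ m)
    (a : reesAlgebra Q) (ha : (a : R[X]) = monomial m b) :
    a ∈ Ideal.span (Set.range (reesDegreeOne Q)) ^ m := by
  induction m generalizing b a with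
  | zero => simp
  | succ m ih =>
    have key : ∀ b ∈ Q ^ m * Q, ∃ a : reesAlgebra Q, (a : R[X]) = monomial (m + 1) b ∧
        a ∈ Ideal.span (Set.range (reesDegreeOne Q)) ^ (m + 1) := by
      intro b hb
      induction hb using Submodule.mul_induction_on' with
      | mem_mul_mem x hx q hq =>
        refine ⟨⟨monomial m x, reesAlgebra.monomial_mem.2 hx⟩ * reesDegreeOne Q ⟨q, hq⟩, ?_, ?_⟩
        · exact monomial_mul_monomial _ _ _ _
        · exact pow_succ (Ideal.span (Set.range (reesDegreeOne Q))) m ▸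
            Ideal.mul_mem_mul (ih hx _ rfl) (Ideal.subset_span ⟨_, rfl⟩)
      | add x _ y _ hx hy =>
        obtain ⟨a, ha, ha'⟩ := hx
        obtain ⟨c, hc, hc'⟩ := hy
        refine ⟨a + c, ?_, Ideal.add_mem _ ha' hc'⟩
        rw [map_add, ← ha, ← hc]
        rfl
    obtain ⟨a', ha', h⟩ := key b (pow_succ Q m ▸ hb)
    rwa [Subtype.ext (ha.trans ha'.symm)]

/-- The filtration `n ↦ Q ^ (n + 1) X`. -/
def shiftedFiltration (Q : Ideal R) (X : Type) [AddCommGroup X] [Module R X] :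
    Q.Filtration X where
  N n := Q ^ (n + 1) • ⊤
  mono n := Submodule.smul_mono_left (Ideal.pow_le_pow_right (Nat.le_succ _))
  smul_le n := by rw [pow_succ' Q (n + 1), mul_smul]

/-- The elements of `N` killed by a power of `J` modulo `N'` control those killed by `a`. -/
lemma exists_finite_primes {A P : Type*} [CommRing A] [IsNoetherianRing A] [AddCommGroup P]
    [Module A P] {N : Submodule A P} (hN : N.FG) (N' : Submodule A P) (J : Ideal A) :
    ∃ T : Set (Ideal A), T.Finite ∧ ∀ a, (∀ p ∈ T, a ∈ p → J ≤ p) →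
      ∃ k : ℕ, ∃ s : Finset P, (∀ y ∈ s, ∀ b ∈ J ^ k, b • y ∈ N') ∧
        ∀ z ∈ N, a • z ∈ N' → z ∈ Submodule.span A (s : Set P) := by
  have : Module.Finite A N := Module.Finite.iff_fg.2 hN
  refine ⟨associatedPrimes A (N ⧸ N'.comap N.subtype), associatedPrimes.finite _ _,
    fun a ha => ?_⟩
  obtain ⟨k, hk⟩ := exists_pow_smul_eq_zero_of_associatedPrimes ha
  let U : Submodule A N :=
    { carrier := {y | ∀ b ∈ J ^ k, b • (y : P) ∈ N'}
      zero_mem' := fun b _ => by simp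
      add_mem' := fun {y y'} hy hy' b hb => by
        rw [Submodule.coe_add, smul_add]
        exact add_mem (hy b hb) (hy' b hb)
      smul_mem' := fun c y hy b hb => by
        rw [Submodule.coe_smul, smul_comm]
        exact N'.smul_mem c (hy b hb) }
  obtain ⟨s, hs⟩ := (IsNoetherian.noetherian U : U.FG)
  classical
  refine ⟨k, s.image N.subtype, fun y hy => ?_, fun z hz haz => ?_⟩
  · obtain ⟨y, hys, rfl⟩ := Finset.mem_image.1 hy
    have hyU : y ∈ U := hs ▸ Submodule.subset_span (Finset.mem_coe.2 hys)
    exact hyU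
  · rw [Finset.coe_image, Submodule.span_image, hs]
    refine ⟨⟨z, hz⟩, fun b hb => ?_, rfl⟩
    have h1 := hk (Submodule.Quotient.mk ⟨z, hz⟩ : N ⧸ N'.comap N.subtype)
      ((Submodule.Quotient.mk_eq_zero _).2 haz) b hb
    exact (Submodule.Quotient.mk_eq_zero (N'.comap N.subtype)).1 h1

/-- A generic element of `Q` acts injectively on the associated graded module in large degrees. -/
lemma eventually_mem_of_smul_mem [IsNoetherianRing R] (Q : Ideal R) (X : Type)
    [AddCommGroup X] [Module R X] [Module.Finite R X] :
    ∀ᶠ h in genericFilter Q, ∃ c : ℕ, ∀ n ≥ c, ∀ z ∈ (Q ^ n • ⊤ : Submodule R X),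
      h • z ∈ (Q ^ (n + 2) • ⊤ : Submodule R X) → z ∈ (Q ^ (n + 1) • ⊤ : Submodule R X) := by
  let J := Ideal.span (Set.range (reesDegreeOne Q))
  let L : Ideal (reesAlgebra Q) → Ideal R := fun P =>
    ((P.restrictScalars R).comap (reesDegreeOne Q)).map Q.subtype
  obtain ⟨T, hT, hT'⟩ := exists_finite_primes
    ((Ideal.Filtration.submodule_fg_iff_stable (Q.stableFiltration (⊤ : Submodule R X))
      fun _ => IsNoetherian.noetherian _).2 (Q.stableFiltration_stable ⊤))
    (shiftedFiltration Q X).submodule J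
  filter_upwards [eventually_genericFilter_mem Q, eventually_genericFilter_of_finite (Q := Q)
    (hT.image L)] with h hhQ hh
  obtain ⟨k, s, hs, hz⟩ := hT' (reesDegreeOne Q ⟨h, hhQ⟩) (fun P hP hhP => by
    have := hh (L P) ⟨P, hP, rfl⟩ ⟨⟨h, hhQ⟩, hhP, rfl⟩
    refine Ideal.span_le.2 ?_
    rintro _ ⟨q, rfl⟩
    obtain ⟨q', hq', hqq'⟩ := this q.2
    rwa [Subtype.ext hqq'] at hq')
  let C := s.sup fun f => f.coeff.support.sup id + 1
  have hC : ∀ f ∈ s, ∀ n ≥ C, f.coeff n = 0 := by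
    intro f hf n hn
    by_contra hne
    have h1 := Finset.le_sup (f := id) (Finsupp.mem_support_iff.2 hne)
    have h2 := Finset.le_sup (f := fun f : PolynomialModule R X => f.coeff.support.sup id + 1) hf
    simp only [id] at h1
    omega
  refine ⟨C + k, fun n hn z hzn hhz => ?_⟩
  have hzs := hz (PolynomialModule.single R n z) (fun i => by
    rw [PolynomialModule.coeff_single, Finsupp.single_apply]
    split_ifs with hi
    · exact hi ▸ hzn
    · exact Submodule.zero_mem _) (fun i => by
    change (monomial 1 h • PolynomialModule.single R n z).coeff i ∈ _
    rw [PolynomialModule.monomial_smul_single, PolynomialModule.coeff_single, Finsupp.single_apply]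
    split_ifs with hi
    · subst hi
      rw [add_comm 1 n]
      exact hhz
    · exact Submodule.zero_mem _)
  have key : ∀ g ∈ Submodule.span (reesAlgebra Q) (s : Set (PolynomialModule R X)),
      g.coeff n ∈ (Q ^ (n + 1) • ⊤ : Submodule R X) := by
    intro g hg
    suffices h1 : ∀ a : reesAlgebra Q, ((a : R[X]) • g).coeff n ∈
        (Q ^ (n + 1) • ⊤ : Submodule R X) by
      have h2 := h1 1
      rwa [OneMemClass.coe_one, one_smul] at h2
    induction hg using Submodule.span_induction with
    | mem f hf =>
      intro a
      rw [PolynomialModule.smul_apply]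
      refine Submodule.sum_mem _ ?_
      rintro ⟨i, l⟩ hil
      rw [Finset.HasAntidiagonal.mem_antidiagonal] at hil
      change (a : R[X]).coeff i • f.coeff l ∈ _
      by_cases hl : C ≤ l
      · rw [hC f hf l hl, smul_zero]
        exact Submodule.zero_mem _
      · have hi : (a : R[X]).coeff i ∈ Q ^ i := a.2 i
        let b : reesAlgebra Q := ⟨monomial i ((a : R[X]).coeff i), reesAlgebra.monomial_mem.2 hi⟩
        have hb : b ∈ J ^ k := Ideal.pow_le_pow_right (by omega : k ≤ i)
          (monomial_mem_pow_reesDegreeOne Q i hi b rfl)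
        have h1 := hs f hf b hb n
        change (monomial i ((a : R[X]).coeff i) • f).coeff n ∈ _ at h1
        rw [PolynomialModule.monomial_smul_apply, if_pos (by omega : i ≤ n),
          (by omega : n - i = l)] at h1
        exact h1
    | zero =>
      intro a
      rw [smul_zero]
      exact Submodule.zero_mem _
    | add f g _ _ hf hg =>
      intro a
      rw [smul_add]
      exact Submodule.add_mem _ (hf a) (hg a)
    | smul c f _ hf =>
      intro a
      have := hf (a * c)
      rw [MulMemClass.coe_mul, mul_smul] at this
      exact this
  have h1 := key _ hzs
  rwa [PolynomialModule.coeff_single, Finsupp.single_eq_same] at h1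

end Superficial

section Superficial

variable {R : Type} [CommRing R] [IsLocalRing R] [IsNoetherianRing R]

lemma eventually_superficial {Q : Ideal R} (hQ : Q ≤ maximalIdeal R) (X : Type)
    [AddCommGroup X] [Module R X] [Module.Finite R X] :
    ∀ᶠ h in genericFilter Q, h ∈ Q ∧
      (∃ c : ℕ, ∀ z ∈ (Q ^ c • ⊤ : Submodule R X), h • z = 0 → z = 0) ∧
      ∃ c : ℕ, ∀ n ≥ c, ∀ z : X, h • z ∈ (Q ^ (n + 1) • ⊤ : Submodule R X) →
        ∃ w ∈ (Q ^ n • ⊤ : Submodule R X), h • w = h • z := by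
  filter_upwards [eventually_genericFilter_mem Q, eventually_mem_of_smul_mem Q X] with h hhQ hc
  obtain ⟨c, hc⟩ := hc
  have mono : ∀ {i j : ℕ}, i ≤ j → (Q ^ j • ⊤ : Submodule R X) ≤ Q ^ i • ⊤ := fun hij =>
    Submodule.smul_mono_left (Ideal.pow_le_pow_right hij)
  have climb : ∀ n ≥ c, ∀ z ∈ (Q ^ c • ⊤ : Submodule R X),
      h • z ∈ (Q ^ (n + 1) • ⊤ : Submodule R X) → z ∈ (Q ^ n • ⊤ : Submodule R X) := by
    intro n hn z hz
    induction n, hn using Nat.le_induction with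
    | base => exact fun _ => hz
    | succ n hn ih => exact fun hhz => hc n hn z (ih (mono (Nat.le_succ _) hhz)) hhz
  refine ⟨hhQ, ⟨c, fun z hz hhz => ?_⟩, ?_⟩
  · have hbot := Ideal.iInf_pow_smul_eq_bot_of_isLocalRing (M := X) Q
      (hQ.trans_lt (maximalIdeal.isMaximal R).ne_top.lt_top).ne
    rw [← Submodule.mem_bot R, ← hbot, Submodule.mem_iInf]
    intro n
    rcases le_total c n with hn | hn
    · exact climb n hn z hz (hhz ▸ Submodule.zero_mem _)
    · exact mono hn hz
  · obtain ⟨k, hk⟩ := Ideal.exists_pow_inf_eq_pow_smul Q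
      (LinearMap.range (LinearMap.lsmul R X h))
    refine ⟨k + c, fun n hn z hz => ?_⟩
    have h1 : h • z ∈ (Q ^ (n + 1) • ⊤ ⊓ LinearMap.range (LinearMap.lsmul R X h) :
        Submodule R X) := ⟨hz, z, rfl⟩
    rw [hk (n + 1) (by omega)] at h1
    have h2 := Submodule.smul_mono (le_refl (Q ^ (n + 1 - k))) inf_le_right h1
    rw [LinearMap.range_eq_map, ← Submodule.map_smul''] at h2
    obtain ⟨w, hw, hwz⟩ := h2
    refine ⟨w, climb n (by omega) w (mono (by omega) hw) ?_, hwz⟩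
    change h • w = h • z at hwz
    rwa [hwz]

end Superficial

section HilbertCoefficients

variable {R : Type} [CommRing R]

lemma exists_length_quotient_pow_eq {Q : Ideal R} (X : Type) [AddCommGroup X] [Module R X] {h : R}
    (hhQ : h ∈ Q) (n : ℕ) :
    ∃ μ : (X ⧸ (Q ^ n • ⊤ : Submodule R X)) →ₗ[R] X ⧸ (Q ^ (n + 1) • ⊤ : Submodule R X),
      (∀ x : X, μ (Submodule.Quotient.mk x) = Submodule.Quotient.mk (h • x)) ∧
      Module.length R (X ⧸ (Q ^ (n + 1) • ⊤ : Submodule R X)) =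
        Module.length R (LinearMap.range μ) +
          Module.length R (QMul h X ⧸ (Q ^ (n + 1) • ⊤ : Submodule R (QMul h X))) := by
  have hle : (Q ^ n • ⊤ : Submodule R X) ≤
      (Q ^ (n + 1) • ⊤ : Submodule R X).comap (LinearMap.lsmul R X h) := by
    intro z hz
    change h • z ∈ (Q ^ (n + 1) • ⊤ : Submodule R X)
    rw [pow_succ', mul_smul]
    exact Submodule.smul_mem_smul hhQ hz
  let μ := Submodule.mapQ _ _ (LinearMap.lsmul R X h) hle
  let mk : X →ₗ[R] QMul h X := Submodule.mkQ _
  have hmk : (Q ^ (n + 1) • ⊤ : Submodule R (QMul h X)) =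
      (Q ^ (n + 1) • ⊤ : Submodule R X).map mk := by
    rw [Submodule.map_smul'', Submodule.map_top, LinearMap.range_eq_top.2 (Submodule.mkQ_surjective _)]
  let π := Submodule.mapQ _ _ mk (Submodule.map_le_iff_le_comap.1 hmk.ge)
  have hπ : Function.Surjective π := by
    intro y
    obtain ⟨y, rfl⟩ := Submodule.mkQ_surjective _ y
    obtain ⟨x, rfl⟩ := Submodule.mkQ_surjective _ y
    exact ⟨Submodule.Quotient.mk x, rfl⟩
  have hμπ : Function.Exact (LinearMap.range μ).subtype π := by
    intro y
    obtain ⟨x, rfl⟩ := Submodule.mkQ_surjective _ y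
    constructor
    · intro hy
      have hx : mk x ∈ (Q ^ (n + 1) • ⊤ : Submodule R (QMul h X)) :=
        (Submodule.Quotient.mk_eq_zero _).1 hy
      rw [hmk] at hx
      obtain ⟨y, hy, hyx⟩ := hx
      obtain ⟨z, hz⟩ := (Submodule.Quotient.eq _).1 hyx.symm
      refine ⟨⟨_, Submodule.Quotient.mk z, rfl⟩, ?_⟩
      refine (Submodule.Quotient.eq _).2 ?_
      have : LinearMap.lsmul R X h z - x = -y := by rw [hz]; abel
      rw [this]
      exact neg_mem hy
    · rintro ⟨⟨_, z, rfl⟩, hz⟩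
      rw [← hz]
      obtain ⟨z, rfl⟩ := Submodule.mkQ_surjective _ z
      change Submodule.Quotient.mk (mk (h • z)) = _
      have : mk (h • z) = 0 := (Submodule.Quotient.mk_eq_zero _).2 ⟨z, rfl⟩
      rw [this, Submodule.Quotient.mk_zero]
  exact ⟨μ, fun _ => rfl,
    Module.length_eq_add_of_exact _ _ (Submodule.subtype_injective _) hπ hμπ⟩

/-- For `Q`-adic filtrations, multiplication by `h ∈ Q` bounds the growth of the lengths. -/
lemma length_quotient_pow_le {Q : Ideal R} (X : Type) [AddCommGroup X] [Module R X] {h : R}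
    (hhQ : h ∈ Q) (n : ℕ) :
    Module.length R (X ⧸ (Q ^ n • ⊤ : Submodule R X)) ≤ n * Module.length R (QMul h X) := by
  induction n with
  | zero => simp
  | succ n ih =>
    obtain ⟨μ, -, hμ⟩ := exists_length_quotient_pow_eq X hhQ n
    rw [hμ, Nat.cast_succ, add_mul, one_mul]
    exact add_le_add ((Module.length_le_of_surjective μ.rangeRestrict
      μ.surjective_rangeRestrict).trans ih)
      (Module.length_le_of_surjective _ (Submodule.mkQ_surjective _))

lemma length_quotient_pow_add {Q : Ideal R} {X : Type} [AddCommGroup X] [Module R X] {h : R}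
    (hhQ : h ∈ Q) {n : ℕ}
    (h0 : ∀ z ∈ (Q ^ n • ⊤ : Submodule R X), h • z = 0 → z = 0)
    (h1 : ∀ z : X, h • z ∈ (Q ^ (n + 1) • ⊤ : Submodule R X) →
        ∃ w ∈ (Q ^ n • ⊤ : Submodule R X), h • w = h • z) :
    Module.length R (X ⧸ (Q ^ (n + 1) • ⊤ : Submodule R X)) +
        Module.length R (LinearMap.ker (LinearMap.lsmul R X h)) =
      Module.length R (X ⧸ (Q ^ n • ⊤ : Submodule R X)) +
        Module.length R (QMul h X ⧸ (Q ^ (n + 1) • ⊤ : Submodule R (QMul h X))) ∧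
    Module.length R (LinearMap.ker (LinearMap.lsmul R X h)) ≤
      Module.length R (X ⧸ (Q ^ n • ⊤ : Submodule R X)) := by
  obtain ⟨μ, hμ, e1⟩ := exists_length_quotient_pow_eq X hhQ n
  have e2 := Module.length_eq_add_of_exact (LinearMap.ker μ).subtype μ.rangeRestrict
    (Submodule.subtype_injective _) μ.surjective_rangeRestrict (by
      rw [LinearMap.exact_iff, LinearMap.ker_rangeRestrict, Submodule.range_subtype])
  let κ : LinearMap.ker (LinearMap.lsmul R X h) →ₗ[R] LinearMap.ker μ :=
    ((Submodule.mkQ _).comp (Submodule.subtype _)).codRestrict _ fun x => by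
      refine (hμ x.1).trans ?_
      rw [show h • x.1 = 0 from x.2, Submodule.Quotient.mk_zero]
  have hκ : Function.Bijective κ := by
    constructor
    · rw [← LinearMap.ker_eq_bot, LinearMap.ker_eq_bot']
      intro x hx
      exact Subtype.ext (h0 _ ((Submodule.Quotient.mk_eq_zero _).1 (congrArg Subtype.val hx)) x.2)
    · rintro ⟨z, hz⟩
      obtain ⟨z, rfl⟩ := Submodule.mkQ_surjective _ z
      obtain ⟨w, hw, hwz⟩ := h1 z ((Submodule.Quotient.mk_eq_zero _).1 ((hμ z).symm.trans hz))
      refine ⟨⟨z - w, ?_⟩, Subtype.ext ((Submodule.Quotient.eq _).2 ?_)⟩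
      · change h • (z - w) = 0
        rw [smul_sub, hwz, sub_self]
      · simpa using hw
  have e3 := (LinearEquiv.ofBijective κ hκ).length_eq
  refine ⟨?_, e3.trans_le (e2 ▸ le_self_add)⟩
  rw [e1, e2, e3]
  abel

lemma hasHilbCoeffs_iff {Q : Ideal R} {X : Type} [AddCommGroup X] [Module R X] {t : ℕ} {s : ℕ → ℤ} :
    HasHilbCoeffs R Q X t s ↔ ∃ N : ℕ, ∀ n ≥ N, ∃ l : ℕ,
      Module.length R (X ⧸ (Q ^ (n + 1) • ⊤ : Submodule R X)) = l ∧
      (l : ℤ) = ∑ i ∈ Finset.range (t + 1), (-1 : ℤ) ^ i * s i * ((n + t - i).choose (t - i) : ℤ) := by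
  unfold HasHilbCoeffs IsHilbPolyAt
  simp only [mLength_eq_coe_iff]

variable [IsLocalRing R] [IsNoetherianRing R]

/-- Passing to the quotient by a generic element keeps all Hilbert coefficients but the last. -/
lemma HasHilbCoeffs.eventually_qMul {Q : Ideal R} (hQ : Q ≤ maximalIdeal R) {X : Type}
    [AddCommGroup X] [Module R X] [Module.Finite R X] {d : ℕ} {e : ℕ → ℤ}
    (he : HasHilbCoeffs R Q X (d + 1) e) :
    ∀ᶠ h in genericFilter Q, ∃ l : ℕ,
      Module.length R (LinearMap.ker (LinearMap.lsmul R X h)) = l ∧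
      HasHilbCoeffs R Q (QMul h X) d (Function.update e d (e d + (-1) ^ d * l)) := by
  filter_upwards [eventually_superficial hQ X] with h ⟨hhQ, ⟨c, hc⟩, c', hc'⟩
  obtain ⟨N, hN⟩ := hasHilbCoeffs_iff.1 he
  have key : ∀ n ≥ max c (max c' N),
      _ := fun n hn => length_quotient_pow_add (X := X) (h := h) (Q := Q) (n := n + 1) hhQ
    (fun z hz => hc z (Submodule.smul_mono_left (Ideal.pow_le_pow_right (by omega)) hz))
    (hc' (n + 1) (by omega))
  have hfin : ∀ n ≥ max c (max c' N), ∃ l l' : ℕ,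
      Module.length R (LinearMap.ker (LinearMap.lsmul R X h)) = l ∧
      Module.length R (QMul h X ⧸ (Q ^ (n + 1 + 1) • ⊤ : Submodule R (QMul h X))) = l' ∧
      (l' : ℤ) = ∑ i ∈ Finset.range (d + 1), (-1 : ℤ) ^ i * e i *
        ((n + 1 + d - i).choose (d - i) : ℤ) + l := by
    intro n hn
    have hk := key n hn
    obtain ⟨p, hp, hp'⟩ := hN n (by omega)
    obtain ⟨q, hq, hq'⟩ := hN (n + 1) (by omega)
    rw [hp, hq] at hk
    obtain ⟨l, hl⟩ := ENat.ne_top_iff_exists.1 (hk.2.trans_lt (ENat.natCast_lt_top p)).ne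
    rw [← hl] at hk ⊢
    have hne : Module.length R
        (QMul h X ⧸ (Q ^ (n + 1 + 1) • ⊤ : Submodule R (QMul h X))) ≠ ⊤ := by
      intro htop
      rw [htop, add_top] at hk
      exact ENat.natCast_ne_top (q + l) hk.1
    obtain ⟨l', hl'⟩ := ENat.ne_top_iff_exists.1 hne
    rw [← hl'] at hk ⊢
    refine ⟨l, l', rfl, rfl, ?_⟩
    have h1 : q + l = p + l' := by exact_mod_cast hk.1
    have h2 : (l' : ℤ) = q - p + l := by omega
    rw [h2, hp', hq', ← Finset.sum_sub_distrib, Finset.sum_range_succ]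
    have h3 : ∀ a : ℕ, a + (d + 1) - (d + 1) = a := fun a => by omega
    simp only [Nat.sub_self, Nat.choose_zero_right, sub_self, add_zero]
    congr 1
    refine Finset.sum_congr rfl fun i hi => ?_
    rw [Finset.mem_range] at hi
    rw [(by omega : n + 1 + (d + 1) - i = (n + 1 + d - i) + 1),
      (by omega : d + 1 - i = (d - i) + 1), (by omega : n + (d + 1) - i = n + 1 + d - i),
      Nat.choose_succ_succ]
    push_cast
    ring
  obtain ⟨l, _, hl, -⟩ := hfin _ le_rfl
  refine ⟨l, hl, hasHilbCoeffs_iff.2 ⟨max c (max c' N) + 1, fun n hn => ?_⟩⟩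
  obtain ⟨n, rfl⟩ : ∃ k, n = k + 1 := ⟨n - 1, by omega⟩
  obtain ⟨l₁, l', hl₁, hl', hsum⟩ := hfin n (by omega)
  obtain rfl : l₁ = l := by exact_mod_cast hl₁.symm.trans hl
  refine ⟨l', hl', ?_⟩
  rw [hsum, Finset.sum_range_succ, Finset.sum_range_succ, Function.update_self]
  have hsq : ((-1 : ℤ) ^ d) * (-1) ^ d = 1 := by rw [← mul_pow]; simp
  simp only [Nat.sub_self, Nat.choose_zero_right, Nat.cast_one, mul_one]
  rw [mul_add, ← mul_assoc, hsq, one_mul, ← add_assoc]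
  congr 2
  refine Finset.sum_congr rfl fun i hi => ?_
  rw [Function.update_of_ne (Finset.mem_range.1 hi).ne]

lemma HasHilbCoeffs.length_eq {Q : Ideal R} (hQ : Q ≤ maximalIdeal R) {X : Type}
    [AddCommGroup X] [Module R X] [Module.Finite R X] {e : ℕ → ℤ}
    (he : HasHilbCoeffs R Q X 0 e) : ∃ l : ℕ, Module.length R X = l ∧ (l : ℤ) = e 0 := by
  obtain ⟨N, hN⟩ := hasHilbCoeffs_iff.1 he
  obtain ⟨l, hl, hl'⟩ := hN N le_rfl
  obtain ⟨l₂, hl₂, hl₂'⟩ := hN (N + 1) (by omega)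
  have : l₂ = l := by simp at hl' hl₂'; omega
  subst this
  have hle : (Q ^ (N + 1 + 1) • ⊤ : Submodule R X) ≤ Q ^ (N + 1) • ⊤ :=
    Submodule.smul_mono_left (Ideal.pow_le_pow_right (Nat.le_succ _))
  have heq : (Q ^ (N + 1) • ⊤ : Submodule R X) = Q ^ (N + 1 + 1) • ⊤ := by
    by_contra hne
    have hlt := Order.coheight_strictAnti (lt_of_le_of_ne hle (Ne.symm hne))
      (by rw [← Module.length_quotient, hl]; exact ENat.natCast_lt_top _)
    rw [← Module.length_quotient, ← Module.length_quotient, hl, hl₂] at hlt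
    exact lt_irrefl _ hlt
  have hbot : (Q ^ (N + 1) • ⊤ : Submodule R X) = ⊥ := by
    refine Submodule.eq_bot_of_le_smul_of_le_jacobson_bot Q _ (IsNoetherian.noetherian _) ?_
      (hQ.trans (maximalIdeal_le_jacobson _))
    rw [← mul_smul, ← pow_succ', ← heq]
  refine ⟨l₂, ?_, by simpa using hl'⟩
  rw [← hl]
  exact ((Submodule.quotEquivOfEqBot _ hbot).length_eq).symm

end HilbertCoefficients

section GenericBound

variable {R : Type} [CommRing R]

lemma length_le_add_of_exact {A B C : Type} [AddCommGroup A] [Module R A] [AddCommGroup B]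
    [Module R B] [AddCommGroup C] [Module R C] (f : A →ₗ[R] B) (g : B →ₗ[R] C)
    (h : ∀ b, g b = 0 → ∃ a, f a = b) :
    Module.length R B ≤ Module.length R A + Module.length R C := by
  rw [Module.length_eq_add_of_exact (LinearMap.ker g).subtype g.rangeRestrict
    (Submodule.subtype_injective _) g.surjective_rangeRestrict (by
      rw [LinearMap.exact_iff, LinearMap.ker_rangeRestrict, Submodule.range_subtype])]
  refine add_le_add ?_ (Module.length_le_of_injective _ (Submodule.subtype_injective _))
  have hle : LinearMap.ker g ≤ LinearMap.range f := fun b hb => h b hb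
  refine (Module.length_le_of_injective (Submodule.inclusion hle)
    (Submodule.inclusion_injective _)).trans ?_
  exact Module.length_le_of_surjective f.rangeRestrict f.surjective_rangeRestrict

/-- A multiplication map on a module of finite length has kernel and cokernel of equal length. -/
lemma length_qMul_eq_length_ker {X : Type} [AddCommGroup X] [Module R X]
    (hX : Module.length R X ≠ ⊤) (h : R) :
    Module.length R (QMul h X) = Module.length R (LinearMap.ker (LinearMap.lsmul R X h)) := by
  let μ := LinearMap.lsmul R X h
  have e1 := Module.length_eq_add_of_exact (LinearMap.range μ).subtype (LinearMap.range μ).mkQ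
    (Submodule.subtype_injective _) (Submodule.mkQ_surjective _)
    (LinearMap.exact_subtype_mkQ _)
  have e2 := Module.length_eq_add_of_exact (LinearMap.ker μ).subtype μ.rangeRestrict
    (Submodule.subtype_injective _) μ.surjective_rangeRestrict (by
      rw [LinearMap.exact_iff, LinearMap.ker_rangeRestrict, Submodule.range_subtype])
  have hr : Module.length R (LinearMap.range μ) ≠ ⊤ := ne_top_of_le_ne_top hX
    (Module.length_le_of_injective _ (Submodule.subtype_injective _))
  rw [e2, add_comm] at e1
  exact (WithTop.add_left_cancel hr e1).symm

lemma smul_eq_zero_of_mem_pow_add {J : Ideal R} {X : Type} [AddCommGroup X] [Module R X] {n k : ℕ} {x : X}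
    (h : ∀ b ∈ J ^ n, ∀ c ∈ J ^ k, b • c • x = 0) : ∀ b ∈ J ^ (n + k), b • x = 0 := by
  intro b hb
  rw [pow_add] at hb
  induction hb using Submodule.mul_induction_on' with
  | mem_mul_mem b hb c hc => exact (mul_smul b c x).trans (h b hb c hc)
  | add b _ c _ hb hc => rw [add_smul, hb, hc, add_zero]

variable [IsLocalRing R]

lemma exists_pow_smul_eq_zero_of_length_ne_top {X : Type} [AddCommGroup X] [Module R X]
    [IsNoetherianRing R] (hX : Module.length R X ≠ ⊤) :
    ∃ N : ℕ, ∀ x : X, ∀ b ∈ maximalIdeal R ^ N, b • x = 0 := by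
  obtain ⟨_, _⟩ := isFiniteLength_iff_isNoetherian_isArtinian.1 (Module.length_ne_top_iff.1 hX)
  let F : ℕ →o (Submodule R X)ᵒᵈ :=
    { toFun := fun n => OrderDual.toDual (maximalIdeal R ^ n • ⊤)
      monotone' := fun i j hij => Submodule.smul_mono_left (Ideal.pow_le_pow_right hij) }
  obtain ⟨N, hN⟩ := IsArtinian.monotone_stabilizes F
  have heq : (maximalIdeal R ^ N • ⊤ : Submodule R X) = maximalIdeal R ^ (N + 1) • ⊤ :=
    hN (N + 1) (Nat.le_succ _)
  have hbot : (maximalIdeal R ^ N • ⊤ : Submodule R X) = ⊥ := by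
    refine Submodule.eq_bot_of_le_smul_of_le_jacobson_bot (maximalIdeal R) _
      (IsNoetherian.noetherian _) ?_ (maximalIdeal_le_jacobson _)
    rw [← mul_smul, ← pow_succ', ← heq]
  refine ⟨N, fun x b hb => ?_⟩
  rw [← Submodule.mem_bot R, ← hbot]
  exact Submodule.smul_mem_smul hb trivial

lemma exists_pow_smul_powTorsion [IsNoetherianRing R] (X : Type) [AddCommGroup X] [Module R X]
    [Module.Finite R X] :
    ∃ N : ℕ, ∀ x ∈ powTorsion (maximalIdeal R) X, ∀ b ∈ maximalIdeal R ^ N, b • x = 0 := by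
  obtain ⟨s, hs⟩ := (IsNoetherian.noetherian (powTorsion (maximalIdeal R) X) :
    (powTorsion (maximalIdeal R) X).FG)
  have : ∀ x : X, ∃ n : ℕ, x ∈ powTorsion (maximalIdeal R) X →
      ∀ r ∈ maximalIdeal R ^ n, r • x = 0 := fun x => by
    by_cases hx : x ∈ powTorsion (maximalIdeal R) X
    · obtain ⟨n, hn⟩ := hx
      exact ⟨n, fun _ => hn⟩
    · exact ⟨0, fun h => absurd h hx⟩
  choose n hn using this
  refine ⟨s.sup n, fun x hx b hb => ?_⟩
  rw [← hs] at hx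
  induction hx using Submodule.span_induction with
  | mem x hx =>
    have hxΓ : x ∈ powTorsion (maximalIdeal R) X := hs ▸ Submodule.subset_span hx
    exact hn x hxΓ b (Ideal.pow_le_pow_right (Finset.le_sup hx) hb)
  | zero => exact smul_zero b
  | add x y _ _ hx hy => rw [smul_add, hx, hy, add_zero]
  | smul c x _ hx => rw [smul_comm, hx, smul_zero]

lemma HasHilbCoeffs.length_powTorsion_ne_top [IsNoetherianRing R] {Q : Ideal R}
    (hQ : Q ≤ maximalIdeal R) {X : Type} [AddCommGroup X] [Module R X] [Module.Finite R X] {t : ℕ}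
    {e : ℕ → ℤ} (he : HasHilbCoeffs R Q X t e) :
    Module.length R (powTorsion (maximalIdeal R) X) ≠ ⊤ := by
  obtain ⟨N, hN⟩ := hasHilbCoeffs_iff.1 he
  obtain ⟨M, hM⟩ := exists_pow_smul_powTorsion (R := R) X
  obtain ⟨k, hk⟩ := Ideal.exists_pow_inf_eq_pow_smul Q (powTorsion (maximalIdeal R) X)
  obtain ⟨l, hl, -⟩ := hN (N + k + M) (by omega)
  refine ne_top_of_le_ne_top (hl ▸ ENat.natCast_ne_top l) (Module.length_le_of_injective
    (Submodule.mkQ _ ∘ₗ (powTorsion (maximalIdeal R) X).subtype) ?_)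
  rw [← LinearMap.ker_eq_bot, LinearMap.ker_eq_bot']
  intro x hx
  have h1 : (x : X) ∈ (Q ^ (N + k + M + 1) • ⊤ ⊓ powTorsion (maximalIdeal R) X : Submodule R X) :=
    ⟨(Submodule.Quotient.mk_eq_zero _).1 hx, x.2⟩
  rw [hk _ (by omega)] at h1
  have h2 := Submodule.smul_mono (Ideal.pow_right_mono hQ _) inf_le_right h1
  refine Subtype.ext ?_
  change (x : X) = 0
  rw [← Submodule.mem_bot R]
  refine Submodule.smul_le.2 (fun b hb y hy => ?_) h2
  exact hM y hy b (Ideal.pow_le_pow_right (by omega) hb)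

/-- After dividing by `k` generic elements of `Q`, the torsion has length at most `v`. -/
def GenericBound (Q : Ideal R) : ℕ → ∀ (X : Type) [AddCommGroup X] [Module R X], ℕ → Prop
  | 0, X, _, _, v => Module.length R (powTorsion (maximalIdeal R) X) ≤ v
  | k + 1, X, _, _, v => ∀ᶠ h in genericFilter Q, GenericBound Q k (QMul h X) v

lemma genericBound_of_length_le (Q : Ideal R) (k : ℕ) {X : Type} [AddCommGroup X] [Module R X] {v : ℕ}
    (hX : Module.length R X ≤ v) : GenericBound Q k X v := by
  induction k generalizing X with
  | zero => exact (Module.length_le_of_injective _ (Submodule.subtype_injective _)).trans hX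
  | succ k ih =>
    exact Filter.Eventually.of_forall fun h =>
      ih ((Module.length_le_of_surjective _ (Submodule.mkQ_surjective _)).trans hX)

lemma GenericBound.of_map [IsNoetherianRing R] {Q : Ideal R} {k : ℕ}
    {A B : Type} [AddCommGroup A] [Module R A] [AddCommGroup B] [Module R B] (f : A →ₗ[R] B)
    (hf : ∃ N : ℕ, ∀ a, f a = 0 → ∀ b ∈ maximalIdeal R ^ N, b • a = 0) {c v : ℕ}
    (hc : Module.length R (B ⧸ LinearMap.range f) ≤ c) (hA : GenericBound Q k A v) :
    GenericBound Q k B (v + c) := by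
  induction k generalizing A B with
  | zero =>
    obtain ⟨N, hN⟩ := hf
    have hΓ : ∀ a ∈ powTorsion (maximalIdeal R) A, f a ∈ powTorsion (maximalIdeal R) B := by
      rintro a ⟨n, hn⟩
      exact ⟨n, fun r hr => by rw [← map_smul, hn r hr, map_zero]⟩
    refine (length_le_add_of_exact (f.restrict hΓ)
      ((LinearMap.range f).mkQ ∘ₗ (powTorsion (maximalIdeal R) B).subtype) ?_).trans
      ((add_le_add hA hc).trans_eq (by push_cast; rfl))
    rintro ⟨b, n, hb⟩ hb0
    obtain ⟨a, rfl⟩ := (Submodule.Quotient.mk_eq_zero _).1 hb0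
    refine ⟨⟨a, N + n, smul_eq_zero_of_mem_pow_add fun r hr s hs => hN _ ?_ r hr⟩, rfl⟩
    rw [map_smul, hb s hs]
  | succ k ih =>
    obtain ⟨N, hN⟩ := hf
    obtain ⟨M, hM⟩ := exists_pow_smul_eq_zero_of_length_ne_top
      (ne_top_of_le_ne_top (ENat.natCast_ne_top c) hc)
    refine Filter.Eventually.mono hA fun h hh => ?_
    let f' : QMul h A →ₗ[R] QMul h B := Submodule.mapQ _ _ f (by
      rintro _ ⟨a, rfl⟩
      exact ⟨f a, (map_smul f h a).symm⟩)
    refine ih f' ⟨N + M, fun a ha => ?_⟩ ?_ hh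
    · obtain ⟨a, rfl⟩ := Submodule.mkQ_surjective _ a
      obtain ⟨b, hb⟩ := (Submodule.Quotient.mk_eq_zero _).1 ha
      change h • b = f a at hb
      refine smul_eq_zero_of_mem_pow_add fun r hr s hs => ?_
      obtain ⟨a', ha'⟩ := (Submodule.Quotient.mk_eq_zero _).1 (hM (Submodule.Quotient.mk b) s hs)
      have h1 : f (s • a - h • a') = 0 := by
        rw [map_sub, map_smul, map_smul, ha', ← hb, smul_comm, sub_self]
      have h2 := hN _ h1 r hr
      rw [smul_sub, sub_eq_zero] at h2
      refine (Submodule.Quotient.mk_eq_zero _).2 ⟨r • a', ?_⟩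
      change h • r • a' = r • s • a
      rw [h2, smul_comm]
    · refine le_trans ?_ hc
      let p : (B ⧸ LinearMap.range f) →ₗ[R] QMul h B ⧸ LinearMap.range f' :=
        (LinearMap.range f).liftQ ((LinearMap.range f').mkQ ∘ₗ Submodule.mkQ _) (by
          rintro _ ⟨a, rfl⟩
          exact (Submodule.Quotient.mk_eq_zero _).2 ⟨Submodule.Quotient.mk a, rfl⟩)
      refine Module.length_le_of_surjective p fun y => ?_
      obtain ⟨y, rfl⟩ := Submodule.mkQ_surjective _ y
      obtain ⟨b, rfl⟩ := Submodule.mkQ_surjective _ y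
      exact ⟨Submodule.Quotient.mk b, rfl⟩

end GenericBound

section HomologicalDegree

variable {R : Type} [CommRing R] [IsLocalRing R]

lemma length_le_length_powTorsion {X Y : Type} [AddCommGroup X] [Module R X] [AddCommGroup Y]
    [Module R Y] (f : X →ₗ[R] Y) (hf : Function.Injective f)
    (h : ∀ x, f x ∈ powTorsion (maximalIdeal R) Y) :
    Module.length R X ≤ Module.length R (powTorsion (maximalIdeal R) Y) :=
  Module.length_le_of_injective (f.codRestrict _ h) fun _ _ hxy => hf (congrArg Subtype.val hxy)

variable [IsNoetherianRing R]

lemma eventually_mem_powTorsion {Q : Ideal R} {a : ℕ} (ha : maximalIdeal R ^ a ≤ Q)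
    (X : Type) [AddCommGroup X] [Module R X] [Module.Finite R X] :
    ∀ᶠ h in genericFilter Q, ∀ x : X, h • x = 0 → x ∈ powTorsion (maximalIdeal R) X := by
  filter_upwards [eventually_exists_pow_smul_eq_zero Q X] with h ⟨N, hN⟩ x hx
  refine ⟨a * N, fun b hb => hN x hx b (Ideal.pow_right_mono ha N ?_)⟩
  rwa [← pow_mul]

lemma exists_pow_smul_lcDual_zero (E : Type) [AddCommGroup E] [Module R E] (X : Type)
    [AddCommGroup X] [Module R X] [Module.Finite R X] :
    ∃ N : ℕ, ∀ φ : LCDual R E 0 X, ∀ b ∈ maximalIdeal R ^ N, b • φ = 0 := by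
  obtain ⟨N, hN⟩ := exists_pow_smul_powTorsion (R := R) X
  obtain ⟨e⟩ := lc_zero_equiv (R := R) X
  refine ⟨N, fun φ b hb => LinearMap.ext fun z => ?_⟩
  have hz : b • z = 0 := e.injective <|
    ((map_smul e b z).trans (Subtype.ext (hN _ (e z).2 b hb))).trans (map_zero e).symm
  exact (map_smul φ b z).symm.trans ((congrArg φ hz).trans (map_zero φ))

lemma length_powTorsion_le_lcDual_zero {E : Type} [AddCommGroup E] [Module R E]
    (hE : IsInjEnvResidue R E) (X : Type) [AddCommGroup X] [Module R X] [Module.Finite R X] :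
    Module.length R (powTorsion (maximalIdeal R) X) ≤
      Module.length R (powTorsion (maximalIdeal R) (LCDual R E 0 X)) := by
  obtain ⟨e⟩ := lc_zero_equiv (R := R) X
  obtain ⟨N, hN⟩ := exists_pow_smul_lcDual_zero (R := R) E X
  rw [← e.length_eq]
  exact (length_le_length_dual hE _).trans
    (length_le_length_powTorsion LinearMap.id Function.injective_id fun φ => ⟨N, hN φ⟩)

section Multiplication

variable {E : Type} [AddCommGroup E] [Module R E] [Module.Injective R E]
  {X : Type} [AddCommGroup X] [Module R X] {h : R}
  (hX : ∀ x : X, h • x = 0 → x ∈ powTorsion (maximalIdeal R) X)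
include hX

lemma finite_lcDual_qMul (j : ℕ) [Module.Finite R (LCDual R E j X)]
    [Module.Finite R (LCDual R E (j + 1) X)] : Module.Finite R (LCDual R E j (QMul h X)) := by
  obtain ⟨f, g, -, hfg, -⟩ := lcDual_mul_sequence (E := E) X h hX j
  have := isNoetherian_of_range_eq_ker f g (Submodule.ext fun ψ => (hfg ψ).symm)
  infer_instance

lemma exists_qMul_lcDual (j : ℕ) : ∃ (f : QMul h (LCDual R E (j + 1) X) →ₗ[R] LCDual R E j (QMul h X))
    (g : LCDual R E j (QMul h X) →ₗ[R] LCDual R E j X), Function.Injective f ∧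
      (∀ ψ, g ψ = 0 ↔ ∃ φ, f φ = ψ) ∧ ∀ ψ, h • g ψ = 0 := by
  obtain ⟨f, g, hf, hfg, hg⟩ := lcDual_mul_sequence (E := E) X h hX j
  refine ⟨Submodule.liftQ _ f ?_, g, ?_, fun ψ => (hfg ψ).trans ⟨?_, ?_⟩, hg⟩
  · rintro _ ⟨ψ, rfl⟩
    exact (hf _).2 ⟨ψ, rfl⟩
  · rw [← LinearMap.ker_eq_bot]
    exact Submodule.ker_liftQ_eq_bot _ _ _ fun φ hφ => (hf φ).1 hφ
  · rintro ⟨φ, rfl⟩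
    exact ⟨Submodule.Quotient.mk φ, rfl⟩
  · rintro ⟨φ, rfl⟩
    obtain ⟨φ, rfl⟩ := Submodule.mkQ_surjective _ φ
    exact ⟨φ, rfl⟩

lemma GenericBound.lcDual_qMul {Q : Ideal R} {j k v v' : ℕ}
    (hj : ∀ φ : LCDual R E j X, h • φ = 0 → φ ∈ powTorsion (maximalIdeal R) (LCDual R E j X))
    (h0 : GenericBound Q 0 (LCDual R E j X) v)
    (hk : GenericBound Q k (QMul h (LCDual R E (j + 1) X)) v') :
    GenericBound Q k (LCDual R E j (QMul h X)) (v' + v) := by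
  obtain ⟨f, g, hf, hfg, hg⟩ := exists_qMul_lcDual (E := E) hX j
  refine hk.of_map f ⟨0, fun a ha b _ => ?_⟩ (le_trans ?_ h0)
  · rw [hf (ha.trans (map_zero f).symm), smul_zero]
  · refine length_le_length_powTorsion ((LinearMap.range f).liftQ g fun ψ hψ => (hfg ψ).2 hψ) ?_ ?_
    · rw [← LinearMap.ker_eq_bot]
      exact Submodule.ker_liftQ_eq_bot _ _ _ fun ψ hψ => (hfg ψ).1 hψ
    · intro ψ
      obtain ⟨ψ, rfl⟩ := Submodule.mkQ_surjective _ ψ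
      exact hj _ (hg ψ)

end Multiplication

lemma sum_choose_add_succ (d : ℕ) (v : ℕ → ℕ) :
    ∑ j ∈ Finset.range (d + 1), d.choose j * (v (j + 1) + v j) =
      ∑ j ∈ Finset.range (d + 2), (d + 1).choose j * v j := by
  rw [Finset.sum_range_succ' _ (d + 1)]
  simp only [Nat.choose_succ_succ, mul_add, add_mul, Finset.sum_add_distrib, Nat.choose_zero_right]
  rw [Finset.sum_range_succ' (fun j => d.choose j * v j), Finset.sum_range_succ (fun j => d.choose (j + 1) * v (j + 1))]
  simp
  ring

section Bound

variable {Q : Ideal R} (hQ : Q ≤ maximalIdeal R) {a : ℕ} (ha : maximalIdeal R ^ a ≤ Q)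
  {E : Type} [AddCommGroup E] [Module R E] (hE : IsInjEnvResidue R E)
include hQ ha hE

lemma genericBound_of_lcDual (k : ℕ) {d : ℕ} {X : Type} [AddCommGroup X] [Module R X]
    [Module.Finite R X] {e : ℕ → ℤ} {e₀ : ℕ} (he : HasHilbCoeffs R Q X (d + 1) e) (he₀ : e 0 = e₀)
    {v : ℕ → ℕ} (hX : ∀ j ≤ d, Module.Finite R (LCDual R E j X))
    (hv : ∀ i ≤ k, ∀ j ≤ d, GenericBound Q i (LCDual R E j X) (v j)) :
    GenericBound Q k X (e₀ + ∑ j ∈ Finset.range (d + 1), d.choose j * v j) := by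
  have := hE.1
  have h0 : Module.length R (powTorsion (maximalIdeal R) X) ≤ v 0 :=
    (length_powTorsion_le_lcDual_zero hE X).trans (hv 0 (Nat.zero_le _) 0 (Nat.zero_le _))
  induction k generalizing d X e e₀ v with
  | zero =>
    refine h0.trans (Nat.cast_le.2 ?_)
    refine le_trans ?_ (Nat.le_add_left _ _)
    refine le_trans ?_ (Finset.single_le_sum (f := fun j => d.choose j * v j)
      (fun _ _ => Nat.zero_le _) (Finset.mem_range.2 (Nat.succ_pos d)))
    simp
  | succ k ih =>
    have hd : ∀ᶠ h in genericFilter Q, ∀ j ∈ Set.Iic d, (∀ φ : LCDual R E j X, h • φ = 0 →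
        φ ∈ powTorsion (maximalIdeal R) (LCDual R E j X)) ∧
        GenericBound Q k (QMul h (LCDual R E j X)) (v j) ∧
        ∀ i < k, GenericBound Q i (QMul h (LCDual R E j X)) (v j) := by
      refine (Filter.eventually_all_finite (Set.finite_Iic d)).2 fun j hj => ?_
      have := hX j hj
      refine (eventually_mem_powTorsion ha _).and ((hv _ le_rfl j hj).and ?_)
      exact (Filter.eventually_all_finite (Set.finite_Iio k)).2 fun i hi =>
        hv (i + 1) (Nat.succ_le_succ (le_of_lt hi)) j hj
    change ∀ᶠ h in genericFilter Q, _
    filter_upwards [he.eventually_qMul hQ, eventually_mem_powTorsion ha X, hd] with h ⟨l, hl, he'⟩ hhX hhd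
    cases d with
    | zero =>
      obtain ⟨m, hm, hm'⟩ := he'.length_eq hQ
      have hlv : (l : ℕ∞) ≤ v 0 := by
        rw [← hl]
        exact (length_le_length_powTorsion (Submodule.subtype _) (Submodule.subtype_injective _)
          fun x => hhX _ x.2).trans h0
      refine genericBound_of_length_le Q k ?_
      rw [hm]
      simp only [Function.update_self, he₀, pow_zero, one_mul] at hm'
      simp only [Nat.cast_le] at hlv ⊢
      simp
      omega
    | succ d =>
      have hf : ∀ j ≤ d, Module.Finite R (LCDual R E j (QMul h X)) := fun j hj => by
        have := hX j (by omega)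
        have := hX (j + 1) (by omega)
        exact finite_lcDual_qMul hhX j
      have hb : ∀ i ≤ k, ∀ j ≤ d, GenericBound Q i (LCDual R E j (QMul h X)) (v (j + 1) + v j) := by
        intro i hi j hj
        refine GenericBound.lcDual_qMul hhX (hhd j (Set.mem_Iic.2 (by omega))).1
          (hv 0 (by omega) j (by omega)) ?_
        obtain ⟨-, h1, h2⟩ := hhd (j + 1) (Set.mem_Iic.2 (by omega))
        rcases hi.lt_or_eq with hi | rfl
        exacts [h2 i hi, h1]
      have := ih he' ((Function.update_of_ne (Nat.succ_ne_zero d).symm _ _).trans he₀) hf hb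
        ((length_powTorsion_le_lcDual_zero hE _).trans (hb 0 (Nat.zero_le _) 0 (Nat.zero_le _)))
      rwa [sum_choose_add_succ] at this

lemma HDegRel.genericBound [IsAdicComplete (maximalIdeal R) R] {X : ModuleCat R} {v : ℕ}
    (h : HDegRel R Q E X v) (hX : Module.Finite R X) (k : ℕ) : GenericBound Q k X v := by
  induction h generalizing k with
  | base M l _ hl => exact genericBound_of_length_le Q k (mLength_eq_coe_iff.1 hl).le
  | step M r _ hr e e₀ he he₀ v hv ih =>
    obtain ⟨d, rfl⟩ := Nat.exists_eq_succ_of_ne_zero hr.ne'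
    have hf : ∀ j ≤ d, Module.Finite R (LCDual R E j M) := fun j hj =>
      (hv j (Nat.lt_succ_of_le hj)).finite hQ (isHausdorff_lcDual E j M)
    exact genericBound_of_lcDual hQ ha hE k he he₀ hf fun i _ j hj =>
      ih j (Nat.lt_succ_of_le hj) (hf j hj) i

end Bound

end HomologicalDegree

section FirstCoefficient

variable {R : Type} [CommRing R] [IsLocalRing R]

lemma length_quotient_pow_le_powTorsion_add (Q : Ideal R) (X : Type) [AddCommGroup X] [Module R X] (n : ℕ) :
    Module.length R (X ⧸ (Q ^ n • ⊤ : Submodule R X)) ≤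
      Module.length R (powTorsion (maximalIdeal R) X) +
        Module.length R ((X ⧸ powTorsion (maximalIdeal R) X) ⧸
          (Q ^ n • ⊤ : Submodule R (X ⧸ powTorsion (maximalIdeal R) X))) := by
  let Γ := powTorsion (maximalIdeal R) X
  have hmap : Submodule.map Γ.mkQ (Q ^ n • ⊤) = Q ^ n • ⊤ := by
    rw [Submodule.map_smul'', Submodule.map_top, Submodule.range_mkQ]
  refine length_le_add_of_exact (Submodule.mkQ _ ∘ₗ Γ.subtype)
    (Submodule.mapQ _ _ Γ.mkQ (Submodule.map_le_iff_le_comap.1 hmap.le)) fun x hx => ?_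
  obtain ⟨x, rfl⟩ := Submodule.mkQ_surjective _ x
  have hx' : Γ.mkQ x ∈ Submodule.map Γ.mkQ (Q ^ n • ⊤) :=
    hmap ▸ (Submodule.Quotient.mk_eq_zero _).1 hx
  obtain ⟨y, hy, hyx⟩ := hx'
  refine ⟨⟨x - y, (Submodule.Quotient.eq Γ).1 hyx.symm⟩, (Submodule.Quotient.eq _).2 ?_⟩
  change x - y - x ∈ _
  rw [sub_sub_cancel_left]
  exact neg_mem hy

variable [IsNoetherianRing R]

lemma length_qMul_quotient_powTorsion_add {X : Type} [AddCommGroup X] [Module R X]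
    [Module.Finite R X] (hΓ : Module.length R (powTorsion (maximalIdeal R) X) ≠ ⊤) {h : R}
    (hX : ∀ x : X, h • x = 0 → x ∈ powTorsion (maximalIdeal R) X) :
    Module.length R (LinearMap.ker (LinearMap.lsmul R X h)) +
      Module.length R (QMul h (X ⧸ powTorsion (maximalIdeal R) X)) ≤ Module.length R (QMul h X) := by
  let Γ := powTorsion (maximalIdeal R) X
  obtain ⟨N, hN⟩ := exists_pow_smul_powTorsion (R := R) X
  let f : QMul h Γ →ₗ[R] QMul h X := Submodule.mapQ _ _ Γ.subtype (by
    rintro _ ⟨x, rfl⟩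
    exact ⟨x, rfl⟩)
  let g : QMul h X →ₗ[R] QMul h (X ⧸ Γ) := Submodule.mapQ _ _ Γ.mkQ (by
    rintro _ ⟨x, rfl⟩
    exact ⟨Γ.mkQ x, (map_smul Γ.mkQ h x).symm⟩)
  have hf : Function.Injective f := by
    rw [← LinearMap.ker_eq_bot, LinearMap.ker_eq_bot']
    intro x hx
    obtain ⟨⟨x, hxΓ⟩, rfl⟩ := Submodule.mkQ_surjective _ x
    obtain ⟨y, hy⟩ := (Submodule.Quotient.mk_eq_zero _).1 hx
    change h • y = x at hy
    have hyΓ : y ∈ Γ := by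
      refine ⟨N + N, smul_eq_zero_of_mem_pow_add fun b hb c hc => hN _ (hX _ ?_) b hb⟩
      rw [smul_comm, hy]
      exact hN x hxΓ c hc
    exact (Submodule.Quotient.mk_eq_zero _).2 ⟨⟨y, hyΓ⟩, Subtype.ext hy⟩
  have hg : Function.Surjective g := by
    intro y
    obtain ⟨y, rfl⟩ := Submodule.mkQ_surjective _ y
    obtain ⟨x, rfl⟩ := Γ.mkQ_surjective y
    exact ⟨Submodule.Quotient.mk x, rfl⟩
  have hfg : Function.Exact f g := by
    intro x
    constructor
    · intro hx
      obtain ⟨x, rfl⟩ := Submodule.mkQ_surjective _ x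
      obtain ⟨y, hy⟩ := (Submodule.Quotient.mk_eq_zero _).1 hx
      obtain ⟨y, rfl⟩ := Γ.mkQ_surjective y
      have hxy : x - h • y ∈ Γ :=
        (Submodule.Quotient.eq Γ).1 (Eq.symm ((map_smul Γ.mkQ h y).trans hy))
      refine ⟨Submodule.Quotient.mk ⟨_, hxy⟩, (Submodule.Quotient.eq _).2 ⟨-y, ?_⟩⟩
      change h • -y = x - h • y - x
      rw [smul_neg]
      abel
    · rintro ⟨y, rfl⟩
      obtain ⟨y, rfl⟩ := Submodule.mkQ_surjective _ y
      refine (Submodule.Quotient.mk_eq_zero _).2 ?_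
      have : Γ.mkQ (y : X) = 0 := (Submodule.Quotient.mk_eq_zero _).2 y.2
      exact this ▸ zero_mem _
  rw [Module.length_eq_add_of_exact f g hf hg hfg, length_qMul_eq_length_ker hΓ]
  gcongr
  let i : LinearMap.ker (LinearMap.lsmul R X h) →ₗ[R] LinearMap.ker (LinearMap.lsmul R Γ h) :=
    LinearMap.codRestrict _ (LinearMap.codRestrict Γ (Submodule.subtype _) fun x => hX _ x.2)
      fun x => Subtype.ext x.2
  refine Module.length_le_of_injective i fun x y hxy => Subtype.ext ?_
  exact congrArg (fun z : LinearMap.ker (LinearMap.lsmul R Γ h) => ((z : Γ) : X)) hxy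

lemma HasHilbCoeffs.neg_coeff_one_le_length_powTorsion [Infinite (ResidueField R)] {Q : Ideal R}
    (hQ : Q ≤ maximalIdeal R) {a : ℕ} (ha : maximalIdeal R ^ a ≤ Q) {X : Type} [AddCommGroup X]
    [Module R X] [Module.Finite R X] {e : ℕ → ℤ} (he : HasHilbCoeffs R Q X 1 e) :
    ∃ g : ℕ, Module.length R (powTorsion (maximalIdeal R) X) = g ∧ -e 1 ≤ g := by
  have := genericFilter_neBot Q
  obtain ⟨h, ⟨l, hl, he'⟩, hX, hhQ⟩ := ((he.eventually_qMul hQ).and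
    ((eventually_mem_powTorsion ha X).and (eventually_genericFilter_mem Q))).exists
  have hΓ := he.length_powTorsion_ne_top hQ
  obtain ⟨m, hm, hm'⟩ := he'.length_eq hQ
  have h1 := length_qMul_quotient_powTorsion_add hΓ hX
  obtain ⟨g, hg⟩ := ENat.ne_top_iff_exists.1 hΓ
  obtain ⟨q, hq⟩ := ENat.ne_top_iff_exists.1 (ne_top_of_le_ne_top (hm ▸ ENat.natCast_ne_top m)
    (le_add_self.trans h1))
  refine ⟨g, hg.symm, ?_⟩
  obtain ⟨N, hN⟩ := hasHilbCoeffs_iff.1 he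
  obtain ⟨k, hk, hk'⟩ := hN N le_rfl
  have h2 := (length_quotient_pow_le_powTorsion_add Q X (N + 1)).trans
    (add_le_add le_rfl (length_quotient_pow_le (X ⧸ powTorsion (maximalIdeal R) X) hhQ (N + 1)))
  rw [hk, ← hg, ← hq] at h2
  rw [hl, hm, ← hq] at h1
  norm_cast at h1 h2
  simp [Finset.sum_range_succ] at hk' hm'
  have h3 : (q : ℤ) ≤ e 0 := by omega
  zify at h2
  nlinarith

lemma length_powTorsion_qMul_le {E : Type} [AddCommGroup E] [Module R E]
    (hE : IsInjEnvResidue R E) {X : Type} [AddCommGroup X] [Module R X] [Module.Finite R X] {h : R}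
    (hX : ∀ x : X, h • x = 0 → x ∈ powTorsion (maximalIdeal R) X)
    (hΓ : Module.length R (powTorsion (maximalIdeal R) X) ≠ ⊤) :
    Module.length R (powTorsion (maximalIdeal R) (QMul h X)) ≤
      Module.length R (LinearMap.ker (LinearMap.lsmul R X h)) +
        Module.length R (powTorsion (maximalIdeal R) (QMul h (LCDual R E 1 X))) := by
  have := hE.1
  obtain ⟨s⟩ := lc_zero_equiv (R := R) X
  obtain ⟨s'⟩ := lc_zero_equiv (R := R) (QMul h X)
  obtain ⟨α, β, hα, hαβ, hβ⟩ := lc_mul_sequence X h hX 0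
  rw [← s'.length_eq]
  let K := LinearMap.ker (LinearMap.lsmul R (LC R 1 X) h)
  refine (length_le_add_of_exact (A := QMul h (LC R 0 X)) (C := K)
    (Submodule.liftQ _ β ?_) (LinearMap.codRestrict K α fun y => (hα _).1 ⟨y, rfl⟩) ?_).trans
    (add_le_add ?_ ?_)
  · rintro _ ⟨x, rfl⟩
    exact hβ x
  · intro y hy
    obtain ⟨x, rfl⟩ := (hαβ y).1 (congrArg Subtype.val hy)
    exact ⟨Submodule.Quotient.mk x, rfl⟩
  · rw [length_qMul_eq_length_ker (by rwa [s.length_eq])]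
    let i : LinearMap.ker (LinearMap.lsmul R (LC R 0 X) h) →ₗ[R] LinearMap.ker (LinearMap.lsmul R X h) :=
      LinearMap.codRestrict _
        (Submodule.subtype _ ∘ₗ s.toLinearMap ∘ₗ Submodule.subtype _) fun x => by
          have hx : h • s x.1 = 0 :=
            (map_smul s h x.1).symm.trans ((congrArg s x.2).trans (map_zero s))
          exact congrArg Subtype.val hx
    refine Module.length_le_of_injective i fun x y hxy => Subtype.ext (s.injective (Subtype.ext ?_))
    exact congrArg (fun z : LinearMap.ker (LinearMap.lsmul R X h) => (z : X)) hxy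
  · refine (length_le_length_dual hE K).trans (le_trans (Module.length_le_of_surjective
      (Submodule.liftQ (LinearMap.range (LinearMap.lsmul R (LCDual R E 1 X) h))
        (LinearMap.lcomp R E K.subtype) ?_) ?_) (?_ : Module.length R (QMul h (LCDual R E 1 X)) ≤ _))
    · rintro _ ⟨φ, rfl⟩
      refine LinearMap.ext fun x => ?_
      exact (map_smul φ h x.1).symm.trans ((congrArg φ x.2).trans (map_zero φ))
    · intro ψ
      obtain ⟨φ, hφ⟩ := Module.Injective.out K.subtype K.subtype_injective ψ
      exact ⟨Submodule.Quotient.mk φ, LinearMap.ext hφ⟩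
    · obtain ⟨f, -, hf, -⟩ := exists_qMul_lcDual (E := E) hX 0
      obtain ⟨N, hN⟩ := exists_pow_smul_lcDual_zero (R := R) E (QMul h X)
      refine length_le_length_powTorsion LinearMap.id Function.injective_id fun φ =>
        ⟨N, fun b hb => hf ?_⟩
      exact (map_smul f b φ).trans ((hN _ b hb).trans (map_zero f).symm)

lemma neg_coeff_one_le [Infinite (ResidueField R)] {Q : Ideal R} (hQ : Q ≤ maximalIdeal R) {a : ℕ}
    (ha : maximalIdeal R ^ a ≤ Q) {E : Type} [AddCommGroup E] [Module R E]
    (hE : IsInjEnvResidue R E) {d : ℕ} {X : Type} [AddCommGroup X] [Module R X] [Module.Finite R X]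
    {e : ℕ → ℤ} (he : HasHilbCoeffs R Q X (d + 2) e) {v : ℕ → ℕ}
    (hX : ∀ j ≤ d, Module.Finite R (LCDual R E (j + 1) X))
    (hv : ∀ i ≤ d + 1, ∀ j ≤ d, GenericBound Q i (LCDual R E (j + 1) X) (v j)) :
    -e 1 ≤ (∑ j ∈ Finset.range (d + 1), d.choose j * v j : ℕ) := by
  have := hE.1
  have := genericFilter_neBot Q
  induction d generalizing X e v with
  | zero =>
    obtain ⟨h, ⟨l, hl, he'⟩, hhX, hb⟩ := ((he.eventually_qMul hQ).and
      ((eventually_mem_powTorsion ha X).and (hv 1 le_rfl 0 le_rfl))).exists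
    obtain ⟨g, hg, hg'⟩ := he'.neg_coeff_one_le_length_powTorsion hQ ha
    have h1 := (length_powTorsion_qMul_le hE hhX (he.length_powTorsion_ne_top hQ)).trans
      (add_le_add le_rfl hb)
    rw [hg, hl] at h1
    norm_cast at h1
    simp at hg' ⊢
    omega
  | succ d ih =>
    have hd : ∀ᶠ h in genericFilter Q, ∀ j ∈ Set.Iic (d + 1), (∀ φ : LCDual R E (j + 1) X,
        h • φ = 0 → φ ∈ powTorsion (maximalIdeal R) (LCDual R E (j + 1) X)) ∧
        ∀ i ∈ Set.Iic (d + 1), GenericBound Q i (QMul h (LCDual R E (j + 1) X)) (v j) := by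
      refine (Filter.eventually_all_finite (Set.finite_Iic _)).2 fun j hj => ?_
      have := hX j hj
      refine (eventually_mem_powTorsion ha _).and ?_
      exact (Filter.eventually_all_finite (Set.finite_Iic _)).2 fun i hi =>
        hv (i + 1) (Nat.succ_le_succ hi) j hj
    obtain ⟨h, ⟨l, hl, he'⟩, hhX, hhd⟩ := ((he.eventually_qMul hQ).and
      ((eventually_mem_powTorsion ha X).and hd)).exists
    have := ih he' (fun j hj => by
        have := hX j (by omega)
        have := hX (j + 1) (by omega)
        exact finite_lcDual_qMul hhX (j + 1)) (v := fun j => v (j + 1) + v j) fun i hi j hj =>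
      GenericBound.lcDual_qMul hhX (hhd j (Set.mem_Iic.2 (by omega))).1
        (hv 0 (by omega) j (by omega)) ((hhd (j + 1) (Set.mem_Iic.2 (by omega))).2 i hi)
    rwa [sum_choose_add_succ, Function.update_of_ne (by omega)] at this

lemma IsParamIdeal.exists_pow_le {Q : Ideal R} {r : ℕ} (hQ : IsParamIdeal R Q R r) :
    ∃ a : ℕ, maximalIdeal R ^ a ≤ Q := by
  obtain ⟨N, hN⟩ := exists_pow_smul_eq_zero_of_length_ne_top (Module.length_ne_top_iff.2 hQ.2.2)
  refine ⟨N, fun b hb => ?_⟩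
  have := (Submodule.Quotient.mk_eq_zero _).1 (hN (Submodule.Quotient.mk 1) b hb)
  simpa using this

end FirstCoefficient

theorem statement17 (R : Type) [CommRing R] [IsLocalRing R] [IsNoetherianRing R]
    [IsAdicComplete (maximalIdeal R) R]
    (hres : Infinite (IsLocalRing.ResidueField R))
    (M : Type) [AddCommGroup M] [Module R M] [Module.Finite R M]
    (r : ℕ) (hr : mDim R M = (r : ℕ∞)) (hrR : mDim R M = ringKrullDim R)
    (hr2 : 2 ≤ r)
    (Q : Ideal R) (hQ : IsParamIdeal R Q R r)
    (e : ℕ → ℤ) (he : HasHilbCoeffs R Q M r e)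
    (E : Type) [AddCommGroup E] [Module R E] (hE : IsInjEnvResidue R E)
    (v : ℕ → ℕ)
    (hv : ∀ j, 1 ≤ j → j ≤ r - 1 →
      HDegRel R Q E (ModuleCat.of R ((LC R j M) →ₗ[R] E)) (v j)) :
    -(e 1) ≤ ∑ j ∈ Finset.Icc 1 (r - 1),
      (((r - 2).choose (j - 1) : ℤ) * (v j : ℤ)) := by
  obtain ⟨a, ha⟩ := hQ.exists_pow_le
  obtain ⟨d, rfl⟩ := Nat.exists_eq_add_of_le' hr2
  have hf : ∀ j ≤ d, Module.Finite R (LCDual R E (j + 1) M) := fun j hj =>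
    (hv (j + 1) (by omega) (by omega)).finite hQ.1 (isHausdorff_lcDual E (j + 1) M)
  have hmain := neg_coeff_one_le hQ.1 ha hE he (v := fun j => v (j + 1)) hf fun i _ j hj =>
    (hv (j + 1) (by omega) (by omega)).genericBound hQ.1 ha hE (hf j hj) i
  refine hmain.trans_eq ?_
  rw [show d + 2 - 1 = d + 1 from rfl, show d + 2 - 2 = d from rfl, ← Finset.Ico_add_one_right_eq_Icc,
    Finset.sum_Ico_eq_sum_range]
  push_cast
  refine Finset.sum_congr rfl fun j _ => ?_
  rw [add_comm 1 j]
  rfl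
end

section
/- Let (R,m) be a Noetherian complete local ring with infinite residue class field and M a finitely generated R-module with dim_R M ≥ 1. Then for every fixed ideal, the set { e_1(Q,M) : Q a parameter ideal for M whose integral closure equals that fixed ideal } is finite. Equivalently, the values e_1(Q,M) taken over all parameter ideals Q for M with a common integral closure form a finite set. -/
open IsLocalRing

/-- If `I' ^ (n + 1) ≤ I * I' ^ n`, then every power of `I'` is eventually divided by `I`. -/
theorem Ideal.pow_add_le_pow_mul_pow {R : Type*} [CommRing R] {I L : Ideal R} {n : ℕ}
    (h : L ^ (n + 1) ≤ I * L ^ n) (s : ℕ) : L ^ (s + n) ≤ I ^ s * L ^ n := by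
  induction s with
  | zero => simp
  | succ s ih =>
    calc L ^ (s + 1 + n) = L * L ^ (s + n) := by ring
      _ ≤ L * (I ^ s * L ^ n) := Ideal.mul_mono_right ih
      _ = I ^ s * L ^ (n + 1) := by ring
      _ ≤ I ^ s * (I * L ^ n) := Ideal.mul_mono_right h
      _ = I ^ (s + 1) * L ^ n := by ring

theorem Ideal.exists_pow_succ_le_mul_pow_trans {R : Type*} [CommRing R] {I I' L : Ideal R}
    (hL : I' ≤ L) (h₁ : ∃ n, I' ^ (n + 1) ≤ I * I' ^ n) (h₂ : ∃ n, L ^ (n + 1) ≤ I' * L ^ n) :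
    ∃ n, L ^ (n + 1) ≤ I * L ^ n := by
  obtain ⟨n, hn⟩ := h₁
  obtain ⟨m, hm⟩ := h₂
  refine ⟨n + m, ?_⟩
  calc L ^ (n + m + 1) = L ^ (n + 1 + m) := by ring
    _ ≤ I' ^ (n + 1) * L ^ m := pow_add_le_pow_mul_pow hm _
    _ ≤ I * I' ^ n * L ^ m := Ideal.mul_mono_left hn
    _ ≤ I * L ^ n * L ^ m := Ideal.mul_mono_left (Ideal.mul_mono_right (Ideal.pow_right_mono hL n))
    _ = I * L ^ (n + m) := by ring

theorem Ideal.mem_colon_iff_span_singleton_mul_le {R : Type*} [CommRing R] {I J : Ideal R} {f : R} :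
    f ∈ I.colon (J : Set R) ↔ Ideal.span {f} * J ≤ I := by
  rw [Submodule.mem_colon_iff_le, ← Submodule.ideal_span_singleton_smul, smul_eq_mul]

/-- The reductions of `L` with `r` generators have bounded reduction numbers. -/
theorem Ideal.exists_uniform_pow_succ_le_mul_pow {R : Type*} [CommRing R] [IsNoetherianRing R]
    (L : Ideal R) (r : ℕ) :
    ∃ N : ℕ, ∀ x : Fin r → R, Ideal.span (Set.range x) ≤ L →
      (∃ n, L ^ (n + 1) ≤ Ideal.span (Set.range x) * L ^ n) →
      L ^ (N + 1) ≤ Ideal.span (Set.range x) * L ^ N := by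
  obtain ⟨g, l, hl⟩ := Submodule.fg_iff_exists_fin_generating_family.mp (IsNoetherian.noetherian L)
  change Ideal.span (Set.range l) = L at hl
  let A := MvPolynomial (Fin r × Fin g) R
  let C : R →+* A := MvPolynomial.C
  set B : Ideal A := L.map C with hB
  let G : Ideal A := Ideal.span (Set.range fun i => ∑ j, MvPolynomial.X (i, j) * C (l j))
  have hlB : ∀ j, C (l j) ∈ B := fun j =>
    Ideal.mem_map_of_mem C (hl ▸ Ideal.subset_span ⟨j, rfl⟩)
  let K : ℕ →o Ideal A := ⟨fun n => (G * B ^ n).colon (B ^ (n + 1) : Ideal A), by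
    refine monotone_nat_of_le_succ fun n f hf => ?_
    rw [Ideal.mem_colon_iff_span_singleton_mul_le] at hf ⊢
    calc Ideal.span {f} * B ^ (n + 1 + 1) = Ideal.span {f} * B ^ (n + 1) * B := by ring
      _ ≤ G * B ^ n * B := Ideal.mul_mono_left hf
      _ = G * B ^ (n + 1) := by ring⟩
  obtain ⟨N, hN⟩ := monotone_stabilizes_iff_noetherian.mpr (inferInstance : IsNoetherian A A) K
  refine ⟨N, fun x hx ⟨n, hn⟩ => ?_⟩
  have hx' : ∀ i, ∃ a : Fin g → R, ∑ j, a j * l j = x i := fun i => by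
    have : x i ∈ Ideal.span (Set.range l) := hl ▸ hx (Ideal.subset_span ⟨i, rfl⟩)
    exact Ideal.mem_span_range_iff_exists_fun.mp this
  choose a ha using hx'
  let ev : A →+* R := MvPolynomial.eval fun p => a p.1 p.2
  have hevC : ∀ y, ev (C y) = y := fun y => MvPolynomial.eval_C y
  have hevX : ∀ i j, ev (MvPolynomial.X (i, j)) = a i j := fun i j => MvPolynomial.eval_X _
  have hG : G.map ev = Ideal.span (Set.range x) := by
    rw [Ideal.map_span, ← Set.range_comp]
    congr 2
    ext i
    simp [hevC, hevX, ha]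
  have hBev : B.map ev = L := by
    rw [hB, Ideal.map_map, show ev.comp C = RingHom.id R from RingHom.ext hevC, Ideal.map_id]
  have hle : (Ideal.span (Set.range x)).map C ≤ G ⊔ RingHom.ker ev * B := by
    rw [Ideal.map_span, Ideal.span_le]
    rintro _ ⟨_, ⟨i, rfl⟩, rfl⟩
    have hxi : C (x i) = ∑ j, MvPolynomial.X (i, j) * C (l j) +
        ∑ j, (C (a i j) - MvPolynomial.X (i, j)) * C (l j) := by
      rw [← Finset.sum_add_distrib, ← ha i, map_sum]
      exact Finset.sum_congr rfl fun j _ => by rw [map_mul]; ring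
    rw [hxi]
    refine Submodule.add_mem_sup (Ideal.subset_span ⟨i, rfl⟩) (_root_.sum_mem fun j _ => ?_)
    refine Ideal.mul_mem_mul ?_ (hlB j)
    rw [RingHom.mem_ker, map_sub, hevC, hevX, sub_self]
  have hnak : B ^ (n + 1) ≤ G * B ^ n ⊔ RingHom.ker ev • B ^ (n + 1) := by
    calc B ^ (n + 1) = (L ^ (n + 1)).map C := (Ideal.map_pow C L _).symm
      _ ≤ (Ideal.span (Set.range x) * L ^ n).map C := Ideal.map_mono hn
      _ = (Ideal.span (Set.range x)).map C * B ^ n := by rw [Ideal.map_mul, Ideal.map_pow]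
      _ ≤ (G ⊔ RingHom.ker ev * B) * B ^ n := Ideal.mul_mono_left hle
      _ = _ := by rw [Ideal.sup_mul, mul_assoc, ← pow_succ', smul_eq_mul]
  obtain ⟨f, hf, hfn⟩ := Submodule.exists_sub_one_mem_and_smul_le_of_fg_of_le_sup
    (IsNoetherian.noetherian (B ^ (n + 1))) le_rfl hnak
  have hf1 : ev f = 1 := by
    rwa [RingHom.mem_ker, map_sub, map_one, sub_eq_zero] at hf
  have hfN : f ∈ K N := by
    have hfK : f ∈ K n := Submodule.mem_colon_iff_le.mpr hfn
    rcases le_total N n with h | h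
    · rwa [hN n h]
    · exact K.monotone h hfK
  have := Ideal.map_mono (f := ev) (Ideal.mem_colon_iff_span_singleton_mul_le.mp hfN)
  simpa [Ideal.map_mul, Ideal.map_pow, Ideal.map_span, hG, hBev, hf1] using this

theorem Ideal.exists_pow_succ_le_of_integral {R : Type*} [CommRing R] {Q I : Ideal R} (hQ : Q ≤ I)
    {x : R} {n : ℕ} (hn : 0 < n) {a : ℕ → R} (ha : ∀ i, 1 ≤ i → i ≤ n → a i ∈ Q ^ i)
    (h : x ^ n + ∑ i ∈ Finset.Icc 1 n, a i * x ^ (n - i) = 0) :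
    ∃ m, (I ⊔ Ideal.span {x}) ^ (m + 1) ≤ I * (I ⊔ Ideal.span {x}) ^ m := by
  obtain ⟨m, rfl⟩ : ∃ m, n = m + 1 := ⟨n - 1, by omega⟩
  refine ⟨m, ?_⟩
  set L := I ⊔ Ideal.span {x} with hL
  have hx : x ∈ L := (le_sup_right : _ ≤ L) (Ideal.mem_span_singleton_self x)
  have hxm : x ^ (m + 1) ∈ I * L ^ m := by
    rw [eq_neg_of_add_eq_zero_left h]
    refine (I * L ^ m).neg_mem (_root_.sum_mem fun i hi => ?_)
    obtain ⟨h1, h2⟩ := Finset.mem_Icc.mp hi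
    obtain ⟨j, rfl⟩ : ∃ j, i = j + 1 := ⟨i - 1, by omega⟩
    have hm : I * L ^ m = I * L ^ j * L ^ (m + 1 - (j + 1)) := by
      rw [mul_assoc, ← pow_add]; congr 2; omega
    rw [hm]
    refine Ideal.mul_mem_mul ?_ (Ideal.pow_mem_pow hx _)
    have := Ideal.pow_right_mono hQ (j + 1) (ha _ h1 h2)
    rw [pow_succ'] at this
    exact Ideal.mul_mono_right (Ideal.pow_right_mono le_sup_left j) this
  have key : ∀ k, L ^ (k + 1) ≤ I * L ^ k ⊔ Ideal.span {x ^ (k + 1)} := by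
    intro k
    induction k with
    | zero => simp [hL]
    | succ k ih =>
      calc L ^ (k + 1 + 1) = L ^ (k + 1) * L := pow_succ _ _
        _ ≤ (I * L ^ k ⊔ Ideal.span {x ^ (k + 1)}) * L := Ideal.mul_mono_left ih
        _ = I * L ^ (k + 1) ⊔ (Ideal.span {x ^ (k + 1)} * I ⊔
              Ideal.span {x ^ (k + 1)} * Ideal.span {x}) := by
            rw [Ideal.sup_mul, mul_assoc, ← pow_succ, ← Ideal.mul_sup]
        _ ≤ _ := by
            refine sup_le le_sup_left (sup_le (le_sup_of_le_left ?_) (le_sup_of_le_right ?_))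
            · rw [mul_comm]
              refine Ideal.mul_mono_right ?_
              rw [Ideal.span_singleton_le_iff_mem]
              exact Ideal.pow_mem_pow hx _
            · rw [Ideal.span_singleton_mul_span_singleton, ← pow_succ]
  refine (key m).trans (sup_le le_rfl ?_)
  rwa [Ideal.span_singleton_le_iff_mem]

theorem le_intClos {R : Type} [CommRing R] (Q : Ideal R) : (Q : Set R) ⊆ intClos R Q := by
  intro x hx
  refine ⟨1, one_pos, fun _ => -x, fun i h1 h2 => ?_, by simp⟩
  obtain rfl : i = 1 := by omega
  simpa using hx

/-- An ideal is a reduction of the ideal generated by its integral closure. -/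
theorem exists_pow_succ_span_intClos_le {R : Type} [CommRing R] [IsNoetherianRing R] (Q : Ideal R) :
    ∃ n, Ideal.span (intClos R Q) ^ (n + 1) ≤ Q * Ideal.span (intClos R Q) ^ n := by
  obtain ⟨t, ht, hspan⟩ := Submodule.fg_span_iff_fg_span_finset_subset (intClos R Q) |>.mp
    (IsNoetherian.noetherian (Ideal.span (intClos R Q)))
  have key : ∀ u : Finset R, (u : Set R) ⊆ intClos R Q →
      ∃ n, (Q ⊔ Ideal.span (u : Set R)) ^ (n + 1) ≤ Q * (Q ⊔ Ideal.span (u : Set R)) ^ n := by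
    classical
    intro u
    induction u using Finset.induction_on with
    | empty => exact fun _ => ⟨0, by simp⟩
    | insert z u _ ih =>
      intro hu
      rw [Finset.coe_insert, Set.insert_subset_iff] at hu
      obtain ⟨⟨n, hn, a, ha, h⟩, hu⟩ := hu
      rw [Finset.coe_insert, Ideal.span_insert, sup_comm (Ideal.span {z}), ← sup_assoc]
      exact Ideal.exists_pow_succ_le_mul_pow_trans le_sup_left (ih hu)
        (Ideal.exists_pow_succ_le_of_integral le_sup_left hn ha h)
  have hL : Q ⊔ Ideal.span (t : Set R) = Ideal.span (intClos R Q) := by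
    refine le_antisymm (sup_le ?_ (Ideal.span_mono ht)) (le_sup_of_le_right hspan.le)
    exact fun x hx => Ideal.subset_span (le_intClos Q hx)
  simpa only [hL] using key t ht

theorem mLength_quotient_mono {R M : Type} [CommRing R] [AddCommGroup M] [Module R M]
    {I J : Ideal R} (h : I ≤ J) :
    mLength R (M ⧸ (J • (⊤ : Submodule R M))) ≤ mLength R (M ⧸ (I • (⊤ : Submodule R M))) := by
  have hle : I • (⊤ : Submodule R M) ≤ J • ⊤ := Submodule.smul_mono_left h
  simp only [mLength, ← Module.coe_length]
  exact WithBot.coe_le_coe.mpr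
    (Module.length_le_of_surjective _ (Submodule.factor_surjective hle))

/-- The function `n ↦ ∑ᵢ cᵢ C(n + t - i, t - i)`. -/
def binomSum (t : ℕ) (c : ℕ → ℤ) (n : ℕ) : ℤ :=
  ∑ i ∈ Finset.range (t + 1), c i * ((n + t - i).choose (t - i) : ℤ)

theorem binomSum_sub (t : ℕ) (c d : ℕ → ℤ) (n : ℕ) :
    binomSum t (c - d) n = binomSum t c n - binomSum t d n := by
  simp [binomSum, sub_mul, Finset.sum_sub_distrib]

theorem binomSum_succ (t : ℕ) (c : ℕ → ℤ) (n : ℕ) :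
    binomSum (t + 1) c n =
      c 0 * ((n + t + 1).choose (t + 1) : ℤ) + binomSum t (fun i => c (i + 1)) n := by
  rw [binomSum, Finset.sum_range_succ', add_comm]
  have h : ∀ i, n + (t + 1) - (i + 1) = n + t - i := fun i => by omega
  simp [binomSum, h, add_assoc]

theorem sum_range_choose_sub (t n : ℕ) :
    ∑ i ∈ Finset.range (t + 1), (n + t - i).choose (t - i) = (n + 1 + t).choose t := by
  induction t with
  | zero => simp
  | succ t ih =>
    rw [Finset.sum_range_succ', add_comm]
    have : ∀ i, (n + (t + 1) - (i + 1)).choose (t + 1 - (i + 1)) = (n + t - i).choose (t - i) := by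
      intro i; congr 1 <;> omega
    simp only [this, ih]
    rw [show n + 1 + (t + 1) = (n + t + 1) + 1 by ring, Nat.choose_succ_succ]
    simp [add_assoc, add_comm, add_left_comm]

theorem binomSum_add_one (t : ℕ) (c : ℕ → ℤ) (n : ℕ) :
    binomSum t c (n + 1) = binomSum t (fun i => ∑ l ∈ Finset.range (i + 1), c l) n := by
  induction t generalizing c with
  | zero => simp [binomSum]
  | succ t ih =>
    rw [binomSum_succ, ih, binomSum_succ]
    have hc : (fun i => ∑ l ∈ Finset.range (i + 1 + 1), c l) =
        fun i => (∑ l ∈ Finset.range (i + 1), c (l + 1)) - (- c 0) := by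
      ext i; rw [Finset.sum_range_succ' _ (i + 1)]; ring
    have hd := binomSum_sub t (fun i => ∑ l ∈ Finset.range (i + 1), c (l + 1)) (fun _ => - c 0) n
    have hs : binomSum t (fun _ => - c 0) n = - c 0 * ((n + 1 + t).choose t : ℤ) := by
      rw [← sum_range_choose_sub, binomSum, ← Finset.mul_sum]; push_cast; rfl
    rw [hc, show (fun i => (∑ l ∈ Finset.range (i + 1), c (l + 1)) - (- c 0)) =
      (fun i => ∑ l ∈ Finset.range (i + 1), c (l + 1)) - fun _ => - c 0 from rfl, hd, hs]
    rw [show n + 1 + t + 1 = (n + 1 + t).succ from rfl, Nat.choose_succ_succ,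
      show n + 1 + t = n + t + 1 by ring]
    push_cast
    simp
    ring

theorem exists_binomSum_add (t : ℕ) (c : ℕ → ℤ) (k : ℕ) :
    ∃ d : ℕ → ℤ, d 0 = c 0 ∧ d 1 = c 1 + k * c 0 ∧
      ∀ n, binomSum t c (n + k) = binomSum t d n := by
  induction k with
  | zero => exact ⟨c, by simp⟩
  | succ k ih =>
    obtain ⟨d, h0, h1, hd⟩ := ih
    refine ⟨fun i => ∑ l ∈ Finset.range (i + 1), d l, by simp [h0], ?_, fun n => ?_⟩
    · dsimp only
      rw [Finset.sum_range_succ, Finset.sum_range_one, h0, h1]; push_cast; ring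
    · rw [← binomSum_add_one, ← hd, add_right_comm, add_assoc]

theorem coeff_zero_nonneg_of_binomSum_nonneg (t : ℕ) (c : ℕ → ℤ) (N : ℕ)
    (h : ∀ n ≥ N, 0 ≤ binomSum t c n) : 0 ≤ c 0 := by
  cases t with
  | zero => simpa [binomSum] using h N le_rfl
  | succ t =>
    by_contra! hc
    obtain ⟨K, hK⟩ : ∃ K : ℕ, ∀ i ∈ Finset.range (t + 1), c (i + 1) ≤ K := by
      refine ⟨∑ i ∈ Finset.range (t + 1), (c (i + 1)).natAbs, fun i hi => ?_⟩
      have := Finset.single_le_sum (f := fun i => (c (i + 1)).natAbs) (fun _ _ => Nat.zero_le _) hi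
      omega
    obtain ⟨n, hnN, hnK⟩ : ∃ n ≥ N, K * (t + 1) ≤ n :=
      ⟨max N (K * (t + 1)), le_max_left _ _, le_max_right _ _⟩
    have hn := h n hnN
    have hb : binomSum t (fun i => c (i + 1)) n ≤ K * ((n + 1 + t).choose t : ℤ) := by
      rw [← sum_range_choose_sub, binomSum]
      push_cast
      rw [Finset.mul_sum]
      exact Finset.sum_le_sum fun i hi => mul_le_mul_of_nonneg_right (hK i hi) (by positivity)
    rw [binomSum_succ] at hn
    have hch := Nat.choose_succ_right_eq (n + 1 + t) t
    rw [show n + 1 + t - t = n + 1 by omega] at hch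
    have hpos : 0 < (n + 1 + t).choose t := Nat.choose_pos (by omega)
    rw [show n + t + 1 = n + 1 + t by ring] at hn
    have h1 : ((n + 1 + t).choose (t + 1) : ℤ) ≤ K * ((n + 1 + t).choose t : ℤ) := by nlinarith
    have h2 : (n + 1 + t).choose (t + 1) * (t + 1) ≤ K * (n + 1 + t).choose t * (t + 1) := by
      exact_mod_cast mul_le_mul_of_nonneg_right h1 (by positivity : (0 : ℤ) ≤ t + 1)
    nlinarith

theorem coeff_one_nonneg_of_binomSum_nonneg (t : ℕ) (c : ℕ → ℤ) (N : ℕ) (hc : c 0 = 0)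
    (h : ∀ n ≥ N, 0 ≤ binomSum (t + 1) c n) : 0 ≤ c 1 :=
  coeff_zero_nonneg_of_binomSum_nonneg t (fun i => c (i + 1)) N fun n hn => by
    simpa [binomSum_succ, hc] using h n hn

/-- If `L ^ (n + k) ≤ Q ^ n` for all `n` and `Q' ≤ L`, then the Hilbert polynomial of `Q'` shifted
by `k` eventually dominates that of `Q`. -/
theorem binomSum_le_of_pow_le {R M : Type} [CommRing R] [AddCommGroup M] [Module R M]
    {L Q Q' : Ideal R} {k t : ℕ} (hQ : ∀ n, L ^ (n + k) ≤ Q ^ n) (hQ' : Q' ≤ L) {e e' : ℕ → ℤ}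
    (he : HasHilbCoeffs R Q M t e) (he' : HasHilbCoeffs R Q' M t e') :
    ∃ N, ∀ n ≥ N, binomSum t (fun i => (-1) ^ i * e i) n ≤
      binomSum t (fun i => (-1) ^ i * e' i) (n + k) := by
  obtain ⟨N, hN⟩ := he
  obtain ⟨N', hN'⟩ := he'
  refine ⟨max N N', fun n hn => ?_⟩
  obtain ⟨l, hl, hle⟩ := hN n (le_trans (le_max_left _ _) hn)
  obtain ⟨l', hl', hle'⟩ := hN' (n + k) (le_trans (le_trans (le_max_right _ _) hn) (by omega))
  rw [binomSum, binomSum, ← hle, ← hle']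
  have hpow : Q' ^ (n + k + 1) ≤ Q ^ (n + 1) :=
    (Ideal.pow_right_mono hQ' _).trans (by simpa [add_right_comm] using hQ (n + 1))
  have := mLength_quotient_mono (M := M) hpow
  dsimp only at hl hl'
  rw [hl, hl'] at this
  exact_mod_cast this

theorem coeff_le_of_pow_le {R M : Type} [CommRing R] [AddCommGroup M] [Module R M]
    {L Q Q' : Ideal R} {k t : ℕ} (hQ : ∀ n, L ^ (n + k) ≤ Q ^ n) (hQ' : Q' ≤ L) {e e' : ℕ → ℤ}
    (he : HasHilbCoeffs R Q M (t + 1) e) (he' : HasHilbCoeffs R Q' M (t + 1) e') :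
    e 0 ≤ e' 0 ∧ (e 0 = e' 0 → e' 1 ≤ e 1 + k * e' 0) := by
  obtain ⟨N, hN⟩ := binomSum_le_of_pow_le hQ hQ' he he'
  obtain ⟨d, h0, h1, hd⟩ := exists_binomSum_add (t + 1) (fun i => (-1) ^ i * e' i) k
  have hpos : ∀ n ≥ N, 0 ≤ binomSum (t + 1) (d - fun i => (-1) ^ i * e i) n := fun n hn => by
    rw [binomSum_sub, ← hd]; linarith [hN n hn]
  have hc0 := coeff_zero_nonneg_of_binomSum_nonneg _ _ N hpos
  simp only [Pi.sub_apply, h0, pow_zero, one_mul] at hc0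
  refine ⟨by linarith, fun h => ?_⟩
  have hc1 := coeff_one_nonneg_of_binomSum_nonneg _ _ N (by simp [h0, h]) hpos
  simp only [Pi.sub_apply, h1, pow_zero, one_mul, pow_one] at hc1
  linarith

theorem statement18 (R : Type) [CommRing R] [IsLocalRing R] [IsNoetherianRing R]
    [IsAdicComplete (maximalIdeal R) R]
    (hres : Infinite (IsLocalRing.ResidueField R))
    (M : Type) [AddCommGroup M] [Module R M] [Module.Finite R M]
    (r : ℕ) (hr : mDim R M = (r : ℕ∞)) (hr1 : 1 ≤ r) :
    ∀ J : Set R,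
      Set.Finite {a : ℤ | ∃ (Q : Ideal R) (e : ℕ → ℤ),
        IsParamIdeal R Q M r ∧ HasHilbCoeffs R Q M r e ∧
        intClos R Q = J ∧ e 1 = a} := by
  intro J
  obtain ⟨t, rfl⟩ : ∃ t, r = t + 1 := ⟨r - 1, by omega⟩
  obtain ⟨N, hN⟩ := Ideal.exists_uniform_pow_succ_le_mul_pow (Ideal.span J) (t + 1)
  have hred : ∀ Q : Ideal R, IsParamIdeal R Q M (t + 1) → intClos R Q = J →
      Q ≤ Ideal.span J ∧ ∀ n, Ideal.span J ^ (n + N) ≤ Q ^ n := by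
    rintro Q ⟨-, ⟨x, rfl⟩, -⟩ rfl
    have hle := (le_intClos (Ideal.span (Set.range x))).trans Ideal.subset_span
    exact ⟨hle, fun n => (Ideal.pow_add_le_pow_mul_pow
      (hN x hle (exists_pow_succ_span_intClos_le _)) n).trans Ideal.mul_le_left⟩
  rcases Set.eq_empty_or_nonempty {a : ℤ | ∃ (Q : Ideal R) (e : ℕ → ℤ),
      IsParamIdeal R Q M (t + 1) ∧ HasHilbCoeffs R Q M (t + 1) e ∧
      intClos R Q = J ∧ e 1 = a} with h | ⟨_, Q₀, e₀, hp₀, he₀, hJ₀, -⟩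
  · rw [h]; exact Set.finite_empty
  obtain ⟨hQ₀, hk₀⟩ := hred Q₀ hp₀ hJ₀
  refine (Set.finite_Icc (e₀ 1 - N * e₀ 0) (e₀ 1 + N * e₀ 0)).subset ?_
  rintro _ ⟨Q, e, hp, he, hJ, rfl⟩
  obtain ⟨hQ, hk⟩ := hred Q hp hJ
  obtain ⟨h1, h2⟩ := coeff_le_of_pow_le hk hQ₀ he he₀
  obtain ⟨h3, h4⟩ := coeff_le_of_pow_le hk₀ hQ he₀ he
  have h0 := le_antisymm h1 h3
  have h5 := h2 h0
  have h6 := h4 h0.symm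
  rw [h0] at h6
  exact ⟨by linarith, h6⟩
end
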